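/- arXiv:2208.10288 — 2 statements merged into one kernel-verified Lean document; each statement's English description precedes it below -/
import Mathlib

section
/- Let A > 1. There exists a constant C > 0, depending only on A, with the following property. Let H be a real Hilbert space, let Γ ⊆ H be a rectifiable curve, let E ⊆ Γ be nonempty, and let G be a partial multiresolution family for E with inflation factor A. Then S_{E,2}(G) := diam E + Σ_{Q ∈ G} β_E(Q)²·diam Q ≤ C·H^1(Γ). -/
open Metric MeasureTheory Set Bornology
open scoped ENNReal NNReal Classical

universe u

noncomputable section

/-- The affine line through `a` with direction `v`. -/
def lineThrough {X : Type u} [AddCommGroup X] [Module ℝ X] (a v : X) : Set X :=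
  {y | ∃ t : ℝ, y = a + t • v}

/-- The Jones beta number of `E` in the window `Q`:
`β_E(Q) = inf_L sup_{x ∈ E ∩ Q} dist(x,L)/diam Q`, with value `0` if `E ∩ Q = ∅`. -/
def jonesBeta {X : Type u} [NormedAddCommGroup X] [NormedSpace ℝ X] (E Q : Set X) : ℝ :=
  if E ∩ Q = ∅ then 0
  else sInf {r : ℝ | ∃ a v : X, v ≠ 0 ∧
    r = sSup ((fun x => infDist x (lineThrough a v) / Metric.diam Q) '' (E ∩ Q))}

/-- `net` encodes a partial multiresolution family for `E`: a nested family of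
`2^{-k}`-separated subsets of `E`. -/
def IsPartialMultiresolution {X : Type u} [NormedAddCommGroup X]
    (E : Set X) (net : ℤ → Set X) : Prop :=
  (∀ k, net k ⊆ E) ∧ (∀ k, net k ⊆ net (k + 1)) ∧
    (∀ k : ℤ, ∀ x ∈ net k, ∀ y ∈ net k, x ≠ y → (2 : ℝ) ^ (-k) ≤ dist x y)

/-- `net` encodes a multiresolution family for `E`: a nested family of `2^{-k}`-nets for `E`. -/
def IsMultiresolution {X : Type u} [NormedAddCommGroup X]
    (E : Set X) (net : ℤ → Set X) : Prop :=
  IsPartialMultiresolution E net ∧ ∀ k : ℤ, ∀ e ∈ E, ∃ x ∈ net k, dist e x ≤ (2 : ℝ) ^ (-k)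

/-- The sum `Σ_{Q ∈ G} β_E(Q)^p · diam Q` over the (partial) multiresolution family
`G = {B(x, A·2^{-k}) : x ∈ net k, k ∈ ℤ}` with inflation factor `A`. -/
def betaSum {X : Type u} [NormedAddCommGroup X] [NormedSpace ℝ X]
    (E : Set X) (net : ℤ → Set X) (A p : ℝ) : ℝ≥0∞ :=
  ∑' (k : ℤ), ∑' (x : net k),
    ENNReal.ofReal (jonesBeta E (closedBall (x : X) (A * (2 : ℝ) ^ (-k))) ^ p *
      Metric.diam (closedBall (x : X) (A * (2 : ℝ) ^ (-k))))

/-- `S_{E,p}(G) = diam E + Σ_{Q ∈ G} β_E(Q)^p · diam Q`. -/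
def SEp {X : Type u} [NormedAddCommGroup X] [NormedSpace ℝ X]
    (E : Set X) (net : ℤ → Set X) (A p : ℝ) : ℝ≥0∞ :=
  ENNReal.ofReal (Metric.diam E) + betaSum E net A p

/-- `Γ` is a rectifiable curve: the image of a continuous map `[0,1] → X` with
finite one-dimensional Hausdorff measure. -/
def IsRectifiableCurve {X : Type u} [NormedAddCommGroup X]
    [MeasurableSpace X] [BorelSpace X] (Γ : Set X) : Prop :=
  (∃ f : ℝ → X, ContinuousOn f (Set.Icc (0 : ℝ) 1) ∧ Γ = f '' Set.Icc (0 : ℝ) 1) ∧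
    μH[1] Γ < ⊤

/-- A point with small excess in the triangle inequality is close to the segment. -/
lemma exists_mem_segment_sq_dist_le {H : Type u} [NormedAddCommGroup H] [InnerProductSpace ℝ H]
    (a b c : H) : ∃ q ∈ segment ℝ a b,
      dist c q ^ 2 ≤ (dist a c + dist c b - dist a b) * (dist a c + dist c b) / 2 := by
  rcases eq_or_lt_of_le (add_nonneg (dist_nonneg (x := a) (y := c)) (dist_nonneg (x := c) (y := b)))
    with h0 | h0
  · have h1 : dist a c = 0 := by linarith [dist_nonneg (x := a) (y := c), dist_nonneg (x := c) (y := b)]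
    refine ⟨a, left_mem_segment ℝ a b, ?_⟩
    rw [← h0, dist_comm c a, h1]
    simp
  · set u := dist a c with hu
    set v := dist c b with hv
    set w := dist a b with hw
    have hu0 : 0 ≤ u := dist_nonneg
    have hv0 : 0 ≤ v := dist_nonneg
    have hw0 : 0 ≤ w := dist_nonneg
    have hwuv : w ≤ u + v := dist_triangle a c b
    have hs : v / (u + v) + u / (u + v) = 1 := by field_simp; ring
    refine ⟨(v / (u + v)) • a + (u / (u + v)) • b,
      ⟨_, _, by positivity, by positivity, hs, rfl⟩, ?_⟩
    set s := v / (u + v) with hsd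
    set t := u / (u + v) with htd
    have e1 : c - (s • a + t • b) = s • (c - a) - t • (b - c) := by
      have : c = (s + t) • c := by rw [hs, one_smul]
      nth_rewrite 1 [this]
      simp only [smul_sub, add_smul]
      abel
    have e2 : w ^ 2 = u ^ 2 + 2 * inner ℝ (c - a) (b - c) + v ^ 2 := by
      rw [hw, hu, hv, dist_comm a b, dist_comm a c, dist_comm c b, dist_eq_norm, dist_eq_norm,
        dist_eq_norm, ← norm_add_sq_real]
      congr 2
      abel
    have e3 : dist c (s • a + t • b) ^ 2
        = s ^ 2 * u ^ 2 - 2 * (s * t * inner ℝ (c - a) (b - c)) + t ^ 2 * v ^ 2 := by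
      rw [dist_eq_norm, e1, norm_sub_sq_real, norm_smul, norm_smul, inner_smul_left,
        inner_smul_right, hu, hv, dist_comm a c, dist_comm c b, dist_eq_norm, dist_eq_norm,
        mul_pow, mul_pow, Real.norm_eq_abs, Real.norm_eq_abs, sq_abs, sq_abs]
      simp only [conj_trivial]
      ring
    have e4 : dist c (s • a + t • b) ^ 2 = u * v * (u + v - w) * (u + v + w) / (u + v) ^ 2 := by
      rw [e3]
      have : inner ℝ (c - a) (b - c) = (w ^ 2 - u ^ 2 - v ^ 2) / 2 := by linarith
      rw [this, hsd, htd]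
      field_simp
      ring
    rw [e4, div_le_iff₀ (by positivity)]
    have h1 : u * v ≤ (u + v) ^ 2 / 4 := by nlinarith [sq_nonneg (u - v)]
    have h2 : 0 ≤ u + v - w := by linarith
    calc u * v * (u + v - w) * (u + v + w)
        ≤ (u + v) ^ 2 / 4 * (u + v - w) * (2 * (u + v)) := by gcongr; linarith
      _ = (u + v - w) * (u + v) / 2 * (u + v) ^ 2 := by ring

/-- Distances to a segment are controlled by the distances of two points through a shorter one. -/
lemma exists_mem_segment_dist_le_add {H : Type u} [NormedAddCommGroup H] [InnerProductSpace ℝ H]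
    {a b e f z q : H} {h h' : ℝ} (he : ∃ q ∈ segment ℝ a b, dist e q ≤ h)
    (hf : ∃ q ∈ segment ℝ a b, dist f q ≤ h) (hq : q ∈ segment ℝ e f) (hz : dist z q ≤ h') :
    ∃ q ∈ segment ℝ a b, dist z q ≤ h' + h := by
  obtain ⟨qe, hqe, hde⟩ := he
  obtain ⟨qf, hqf, hdf⟩ := hf
  obtain ⟨s, t, hs, ht, hst, rfl⟩ := hq
  refine ⟨s • qe + t • qf, (convex_segment a b) hqe hqf hs ht hst, ?_⟩
  refine (dist_triangle _ _ _).trans (add_le_add hz ?_)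
  rw [dist_eq_norm] at *
  have : s • e + t • f - (s • qe + t • qf) = s • (e - qe) + t • (f - qf) := by
    simp only [smul_sub]; abel
  rw [this]
  calc ‖s • (e - qe) + t • (f - qf)‖ ≤ ‖s • (e - qe)‖ + ‖t • (f - qf)‖ := norm_add_le _ _
    _ = s * ‖e - qe‖ + t * ‖f - qf‖ := by
      rw [norm_smul, norm_smul, Real.norm_of_nonneg hs, Real.norm_of_nonneg ht]
    _ ≤ s * h + t * h := by gcongr
    _ = h := by rw [← add_mul, hst, one_mul]

/-- Every index lying between two members of `S` lies in a gap between consecutive members. -/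
lemma exists_consecutive (S : Finset ℕ) {a b j : ℕ} (ha : a ∈ S) (hb : b ∈ S) (haj : a ≤ j)
    (hjb : j < b) : ∃ e ∈ S, ∃ f ∈ S, a ≤ e ∧ e ≤ j ∧ j < f ∧ f ≤ b ∧
      ∀ i ∈ S, ¬ (e < i ∧ i < f) := by
  obtain ⟨e, he, hemax⟩ := (S.filter (· ≤ j)).exists_max_image id ⟨a, by simp [ha, haj]⟩
  obtain ⟨f, hf, hfmin⟩ := (S.filter (j < ·)).exists_min_image id ⟨b, by simp [hb, hjb]⟩
  simp only [Finset.mem_filter, id] at he hf hemax hfmin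
  refine ⟨e, he.1, f, hf.1, hemax a ⟨ha, haj⟩, he.2, hf.2, hfmin b ⟨hb, hjb⟩, ?_⟩
  rintro i hi ⟨h1, h2⟩
  rcases le_or_gt i j with h | h
  · have := hemax i ⟨hi, h⟩; omega
  · have := hfmin i ⟨hi, h⟩; omega

/-- The arc `p a, …, p b` reaches out of the ball `B(x,R)` at both ends, stays in `B(x,3R/2)`, and
deviates from its chord by at most `h`. -/
def IsFlatArc {H : Type u} [NormedAddCommGroup H] [InnerProductSpace ℝ H] (p : ℕ → H) (N : ℕ)
    (x : H) (t : ℕ) (R h : ℝ) (a b : ℕ) : Prop :=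
  a ≤ t ∧ t ≤ b ∧ b ≤ N ∧ R < dist (p a) x ∧ R < dist (p b) x ∧
    ∀ j, a ≤ j → j ≤ b → dist (p j) x ≤ 3 / 2 * R ∧ ∃ q ∈ segment ℝ (p a) (p b), dist (p j) q ≤ h

/-- The state of the shortcutting procedure: `S` is the set of surviving indices and `φ` a
cumulative budget dominating chord lengths. Each gap between survivors stems from an item in `s`. -/
structure ShortcutState {ι H : Type*} [NormedAddCommGroup H] [InnerProductSpace ℝ H] (p : ℕ → H)
    (N : ℕ) (R : ι → ℝ) (x : ι → H) (s : Finset ι) (S : Finset ℕ) (φ : ℕ → ℝ) : Prop where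
  le_of_mem : ∀ i ∈ S, i ≤ N
  zero_mem : 0 ∈ S
  last_mem : N ∈ S
  dist_le : ∀ a ∈ S, ∀ b ∈ S, a ≤ b → dist (p a) (p b) ≤ φ b - φ a
  gap : ∀ e ∈ S, ∀ f ∈ S, e < f → (∀ i ∈ S, ¬ (e < i ∧ i < f)) → f = e + 1 ∨
    ∃ k ∈ s, ∀ j, e ≤ j → j ≤ f → dist (p j) (x k) ≤ 3 / 2 * R k ∧
      ∃ q ∈ segment ℝ (p e) (p f),
        dist (p j) q ≤ √(24 * R k * (φ f - φ e - dist (p e) (p f)))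

lemma ShortcutState.exists_step {ι H : Type*} [NormedAddCommGroup H] [InnerProductSpace ℝ H]
    {p : ℕ → H} {N : ℕ} {R : ι → ℝ} {x : ι → H} {s : Finset ι} {S : Finset ℕ} {φ : ℕ → ℝ}
    (hS : ShortcutState p N R x s S φ) {k : ι} {t : ℕ} (hk : 0 < R k) (htN : t ≤ N)
    (htx : p t = x k) (h0 : R k < dist (p 0) (x k)) (hN : R k < dist (p N) (x k))
    (hstep : ∀ j < N, dist (p j) (p (j + 1)) ≤ R k / 4)
    (hsep : ∀ i ∈ s, (0 < R i ∧ R i ≤ R k) ∧ (12 * R i ≤ R k ∨ 4 * R k ≤ dist (x i) (x k))) :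
    ∃ (S' : Finset ℕ) (φ' : ℕ → ℝ) (a b : ℕ) (c : ℝ), 0 ≤ c ∧
      ShortcutState p N R x (insert k s) S' φ' ∧ c + 2 * (φ' N - φ' 0) = 2 * (φ N - φ 0) ∧
      IsFlatArc p N (x k) t (R k) √(12 * R k * c) a b := by
  obtain ⟨a, ha, hamax⟩ := (S.filter (fun i => i ≤ t ∧ R k < dist (p i) (x k))).exists_max_image id
    ⟨0, by simp [hS.zero_mem, h0]⟩
  obtain ⟨b, hb, hbmin⟩ := (S.filter (fun i => t ≤ i ∧ R k < dist (p i) (x k))).exists_min_image id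
    ⟨N, by simp [hS.last_mem, hN, htN]⟩
  simp only [Finset.mem_filter, id] at ha hb hamax hbmin
  obtain ⟨haS, hat, haR⟩ := ha
  obtain ⟨hbS, htb, hbR⟩ := hb
  have hatlt : a < t := lt_of_le_of_ne hat (by rintro rfl; rw [htx, dist_self] at haR; linarith)
  have htblt : t < b := lt_of_le_of_ne htb (by rintro rfl; rw [htx, dist_self] at hbR; linarith)
  have hbN := hS.le_of_mem b hbS
  have hin : ∀ i ∈ S, a < i → i < b → dist (p i) (x k) ≤ R k := by
    intro i hi h1 h2
    by_contra! h3
    rcases le_total i t with h | h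
    · have := hamax i ⟨hi, h, h3⟩; omega
    · have := hbmin i ⟨hi, h, h3⟩; omega
  -- gaps inside `[a, b]` are small
  have hgap : ∀ e ∈ S, ∀ f ∈ S, a ≤ e → e < f → f ≤ b → (∀ i ∈ S, ¬ (e < i ∧ i < f)) →
      ¬ (e = a ∧ f = b) ∧ (f = e + 1 ∨ ∃ i ∈ s, 12 * R i ≤ R k ∧ 0 < R i ∧ ∀ j, e ≤ j → j ≤ f →
        dist (p j) (x i) ≤ 3 / 2 * R i ∧ ∃ q ∈ segment ℝ (p e) (p f),
        dist (p j) q ≤ √(24 * R i * (φ f - φ e - dist (p e) (p f)))) := by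
    intro e he f hf hae hef hfb hno
    rcases hS.gap e he f hf hef hno with h | ⟨i, his, hi⟩
    · refine ⟨?_, Or.inl h⟩
      rintro ⟨rfl, rfl⟩; omega
    obtain ⟨⟨hi0, hik⟩, hi2⟩ := hsep i his
    have hea : ¬ (e = a ∧ f = b) := by
      rintro ⟨rfl, rfl⟩
      have h1 := (hi t hat htb).1
      have h2 := (hi e le_rfl hef.le).1
      rw [htx] at h1
      rcases hi2 with h | h
      · have := dist_triangle (p e) (x i) (x k)
        rw [dist_comm (x i)] at this
        linarith
      · rw [dist_comm] at h
        linarith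
    refine ⟨hea, Or.inr ⟨i, his, ?_, hi0, hi⟩⟩
    rcases hi2 with h | h
    · exact h
    exfalso
    have key : ∀ j, e ≤ j → j ≤ f → R k < dist (p j) (x k) := by
      intro j h1 h2
      have h3 := (hi j h1 h2).1
      have := dist_triangle (x i) (p j) (x k)
      rw [dist_comm (x i) (p j)] at this
      linarith
    rcases eq_or_lt_of_le hae with h1 | h1
    · rcases eq_or_lt_of_le hfb with h2 | h2
      · exact hea ⟨h1.symm, h2⟩
      · have := key f hef.le le_rfl
        linarith [hin f hf (by omega) h2]
    · have := key e le_rfl hef.le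
      linarith [hin e he h1 (by omega)]
  have hclose : ∀ e ∈ S, ∀ f ∈ S, a ≤ e → e < f → f ≤ b → (∀ i ∈ S, ¬ (e < i ∧ i < f)) →
      ∀ j, e ≤ j → j ≤ f → dist (p j) (x k) ≤ 3 / 2 * R k := by
    intro e he f hf hae hef hfb hno j hej hjf
    obtain ⟨h1, h2⟩ := hgap e he f hf hae hef hfb hno
    have hdiam : ∀ j', e ≤ j' → j' ≤ f → dist (p j) (p j') ≤ R k / 4 := by
      intro j' h3 h4
      rcases h2 with h2 | ⟨i, -, hi1, hi0, hi2⟩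
      · have hst := hstep e (by omega)
        have hj : j = e ∨ j = e + 1 := by omega
        have hj' : j' = e ∨ j' = e + 1 := by omega
        rcases hj with rfl | rfl <;> rcases hj' with rfl | rfl
        · rw [dist_self]; linarith
        · exact hst
        · rw [dist_comm]; exact hst
        · rw [dist_self]; linarith
      · have := dist_triangle (p j) (x i) (p j')
        have h5 := (hi2 j hej hjf).1
        have h6 := (hi2 j' h3 h4).1
        rw [dist_comm (p j')] at h6
        linarith
    have : dist (p e) (x k) ≤ R k ∨ dist (p f) (x k) ≤ R k := by
      rcases eq_or_lt_of_le hae with h3 | h3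
      · rcases eq_or_lt_of_le hfb with h4 | h4
        · exact absurd ⟨h3.symm, h4⟩ h1
        · exact Or.inr (hin f hf (by omega) h4)
      · exact Or.inl (hin e he h3 (by omega))
    rcases this with h | h
    · have := dist_triangle (p j) (p e) (x k)
      linarith [hdiam e le_rfl hef.le]
    · have := dist_triangle (p j) (p f) (x k)
      linarith [hdiam f hef.le le_rfl]
  have hclose' : ∀ j, a ≤ j → j ≤ b → dist (p j) (x k) ≤ 3 / 2 * R k := by
    intro j h1 h2
    rcases eq_or_lt_of_le h2 with rfl | h3
    · obtain ⟨e, he, f, hf, h4, h5, h6, h7, h8⟩ :=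
        exists_consecutive S haS hbS (j := j - 1) (by omega) (by omega)
      exact hclose e he f hf h4 (by omega) h7 h8 j (by omega) (by omega)
    · obtain ⟨e, he, f, hf, h4, h5, h6, h7, h8⟩ := exists_consecutive S haS hbS h1 h3
      exact hclose e he f hf h4 (by omega) h7 h8 j h5 h6.le
  set c := φ b - φ a - dist (p a) (p b) with hc
  have hc0 : 0 ≤ c := by
    have := hS.dist_le a haS b hbS (by omega)
    linarith
  have halive : ∀ i ∈ S, a ≤ i → i ≤ b → ∃ q ∈ segment ℝ (p a) (p b),
      dist (p i) q ≤ √(3 * R k * c) := by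
    intro i hi h1 h2
    obtain ⟨q, hq, hq2⟩ := exists_mem_segment_sq_dist_le (p a) (p b) (p i)
    refine ⟨q, hq, Real.le_sqrt_of_sq_le (hq2.trans ?_)⟩
    have h3 := hS.dist_le a haS i hi h1
    have h4 := hS.dist_le i hi b hbS h2
    have h5 : dist (p a) (p i) ≤ 3 * R k := by
      have := dist_triangle_right (p a) (p i) (x k)
      linarith [hclose' a le_rfl (by omega), hclose' i h1 h2]
    have h6 : dist (p i) (p b) ≤ 3 * R k := by
      have := dist_triangle_right (p i) (p b) (x k)
      linarith [hclose' b (by omega) le_rfl, hclose' i h1 h2]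
    have h7 := dist_triangle (p a) (p i) (p b)
    calc _ ≤ c * (6 * R k) / 2 := by
          gcongr
          · linarith
          · linarith
      _ = 3 * R k * c := by ring
  have hdev : ∀ j, a ≤ j → j ≤ b → ∃ q ∈ segment ℝ (p a) (p b),
      dist (p j) q ≤ √(12 * R k * c) := by
    intro j h1 h2
    have hmono : √(3 * R k * c) ≤ √(12 * R k * c) := by gcongr; norm_num
    by_cases hj : j ∈ S
    · obtain ⟨q, hq, hq2⟩ := halive j hj h1 h2
      exact ⟨q, hq, hq2.trans hmono⟩
    have hjb : j < b := lt_of_le_of_ne h2 (by rintro rfl; exact hj hbS)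
    obtain ⟨e, he, f, hf, h4, h5, h6, h7, h8⟩ := exists_consecutive S haS hbS h1 hjb
    rcases (hgap e he f hf h4 (by omega) h7 h8).2 with h9 | ⟨i, -, hi1, hi0, hi2⟩
    · have : j = e := by omega
      exact absurd (this ▸ he) hj
    obtain ⟨q, hq, hq2⟩ := (hi2 j h5 h6.le).2
    have hexc : φ f - φ e - dist (p e) (p f) ≤ c := by
      have i1 := hS.dist_le a haS e he h4
      have i2 := hS.dist_le f hf b hbS h7
      have i3 := dist_triangle4 (p a) (p e) (p f) (p b)
      linarith
    have hexc0 : 0 ≤ φ f - φ e - dist (p e) (p f) := by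
      linarith [hS.dist_le e he f hf (by omega)]
    have hq3 : dist (p j) q ≤ √(2 * R k * c) := by
      refine hq2.trans (Real.sqrt_le_sqrt ?_)
      calc 24 * R i * (φ f - φ e - dist (p e) (p f)) ≤ 24 * R i * c := by gcongr
        _ = 2 * (12 * R i) * c := by ring
        _ ≤ 2 * R k * c := by gcongr
    obtain ⟨q', hq', hq4⟩ := exists_mem_segment_dist_le_add (halive e he h4 (by omega))
      (halive f hf (by omega) h7) hq hq3
    refine ⟨q', hq', hq4.trans (Real.le_sqrt_of_sq_le ?_)⟩
    have s2 := Real.sq_sqrt (show 0 ≤ 2 * R k * c by positivity)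
    have s3 := Real.sq_sqrt (show 0 ≤ 3 * R k * c by positivity)
    have : 0 ≤ R k * c := by positivity
    nlinarith [sq_nonneg (√(2 * R k * c) - √(3 * R k * c))]
  refine ⟨S.filter (fun i => ¬ (a < i ∧ i < b)), fun i => φ i - if b ≤ i then c / 2 else 0, a, b, c,
    hc0, ?_, ?_, ⟨hat, htb, hbN, haR, hbR, fun j h1 h2 => ⟨hclose' j h1 h2, hdev j h1 h2⟩⟩⟩
  swap
  · beta_reduce
    rw [if_pos hbN, if_neg (by omega)]
    ring
  constructor
  · intro i hi
    exact hS.le_of_mem i (Finset.mem_filter.1 hi).1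
  · simp [hS.zero_mem]
  · simp only [Finset.mem_filter, hS.last_mem, true_and]; omega
  · intro a' ha' b' hb' hab
    simp only [Finset.mem_filter] at ha' hb'
    have i1 := hS.dist_le a' ha'.1 b' hb'.1 hab
    by_cases h1 : b ≤ b'
    · by_cases h2 : b ≤ a'
      · simp only [h1, h2, if_true]; linarith
      · have h3 : a' ≤ a := by omega
        simp only [h1, h2, if_true, if_false]
        have i2 := hS.dist_le a' ha'.1 a haS h3
        have i3 := hS.dist_le b hbS b' hb'.1 h1
        have i4 := dist_triangle4 (p a') (p a) (p b) (p b')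
        linarith
    · have h2 : ¬ b ≤ a' := by omega
      simp only [h1, h2, if_false]; linarith
  · intro e he f hf hef hno
    simp only [Finset.mem_filter] at he hf hno
    by_cases hnew : e = a ∧ f = b
    · obtain ⟨rfl, rfl⟩ := hnew
      refine Or.inr ⟨k, Finset.mem_insert_self _ _, fun j h1 h2 => ⟨hclose' j h1 h2, ?_⟩⟩
      obtain ⟨q, hq, hq2⟩ := hdev j h1 h2
      refine ⟨q, hq, hq2.trans_eq ?_⟩
      rw [if_pos le_rfl, if_neg (by omega)]
      congr 1
      rw [hc]; ring
    · have hout : f ≤ a ∨ b ≤ e := by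
        have n1 := hno a ⟨haS, by omega⟩
        have n2 := hno b ⟨hbS, by omega⟩
        omega
      have hno' : ∀ i ∈ S, ¬ (e < i ∧ i < f) := by
        intro i hi h1
        exact hno i ⟨hi, by omega⟩ h1
      have hφ : (φ f - if b ≤ f then c / 2 else 0) - (φ e - if b ≤ e then c / 2 else 0)
          = φ f - φ e := by
        rcases hout with h | h
        · rw [if_neg (by omega), if_neg (by omega)]; ring
        · rw [if_pos (by omega), if_pos h]; ring
      rcases hS.gap e he.1 f hf.1 hef hno' with h | ⟨i, his, hi⟩
      · exact Or.inl h
      · refine Or.inr ⟨i, Finset.mem_insert_of_mem his, ?_⟩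
        rw [hφ]
        exact hi

/-- Arcs around separated points of a discrete curve deviate little from their chords:
the quadratic deviations are summable against the length. -/
theorem exists_flatArcs {ι H : Type*} [NormedAddCommGroup H] [InnerProductSpace ℝ H]
    {p : ℕ → H} {N : ℕ} {R : ι → ℝ} {x : ι → H} {t : ι → ℕ} (s : Finset ι)
    (hR : ∀ i ∈ s, 0 < R i) (htN : ∀ i ∈ s, t i ≤ N) (htx : ∀ i ∈ s, p (t i) = x i)
    (h0 : ∀ i ∈ s, R i < dist (p 0) (x i)) (hN : ∀ i ∈ s, R i < dist (p N) (x i))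
    (hstep : ∀ i ∈ s, ∀ j < N, dist (p j) (p (j + 1)) ≤ R i / 4)
    (hsep : ∀ i ∈ s, ∀ j ∈ s, i ≠ j → R i ≤ R j → 12 * R i ≤ R j ∨ 4 * R j ≤ dist (x i) (x j)) :
    ∃ c : ι → ℝ, (∀ i, 0 ≤ c i) ∧
      ∑ i ∈ s, c i ≤ 2 * ∑ j ∈ Finset.range N, dist (p j) (p (j + 1)) ∧
      ∀ i ∈ s, ∃ a b, IsFlatArc p N (x i) (t i) (R i) √(12 * R i * c i) a b := by
  suffices h : ∃ (S : Finset ℕ) (φ : ℕ → ℝ) (c : ι → ℝ), (∀ i, 0 ≤ c i) ∧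
      ShortcutState p N R x s S φ ∧
      ∑ i ∈ s, c i + 2 * (φ N - φ 0) ≤ 2 * ∑ j ∈ Finset.range N, dist (p j) (p (j + 1)) ∧
      ∀ i ∈ s, ∃ a b, IsFlatArc p N (x i) (t i) (R i) √(12 * R i * c i) a b by
    obtain ⟨S, φ, c, hc, hS, hsum, hout⟩ := h
    refine ⟨c, hc, ?_, hout⟩
    have := hS.dist_le 0 hS.zero_mem N hS.last_mem (Nat.zero_le _)
    linarith [dist_nonneg (x := p 0) (y := p N)]
  induction s using Finset.induction_on_max_value R with
  | empty =>
    refine ⟨Finset.range (N + 1), fun n => ∑ j ∈ Finset.range n, dist (p j) (p (j + 1)),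
      fun _ => 0, fun _ => le_rfl, ⟨?_, by simp, by simp, ?_, ?_⟩, by simp, by simp⟩
    · intro i hi; rw [Finset.mem_range] at hi; omega
    · intro a _ b _ hab
      rw [← Finset.sum_Ico_eq_sub _ hab]
      exact dist_le_Ico_sum_dist p hab
    · intro e he f hf hef hno
      left
      by_contra h
      rw [Finset.mem_range] at hf
      exact hno (e + 1) (by rw [Finset.mem_range]; omega) (by omega)
  | insert k s hks hmax ih =>
    obtain ⟨S, φ, c, hc, hS, hsum, hout⟩ := ih (fun i hi => hR i (Finset.mem_insert_of_mem hi))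
      (fun i hi => htN i (Finset.mem_insert_of_mem hi))
      (fun i hi => htx i (Finset.mem_insert_of_mem hi))
      (fun i hi => h0 i (Finset.mem_insert_of_mem hi))
      (fun i hi => hN i (Finset.mem_insert_of_mem hi))
      (fun i hi => hstep i (Finset.mem_insert_of_mem hi))
      (fun i hi j hj => hsep i (Finset.mem_insert_of_mem hi) j (Finset.mem_insert_of_mem hj))
    have hk := Finset.mem_insert_self k s
    obtain ⟨S', φ', a, b, c', hc', hS', hsum', hout'⟩ := hS.exists_step (hR k hk) (htN k hk)
      (htx k hk) (h0 k hk) (hN k hk) (hstep k hk) (fun i hi =>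
        ⟨⟨hR i (Finset.mem_insert_of_mem hi), hmax i hi⟩,
          hsep i (Finset.mem_insert_of_mem hi) k hk (by rintro rfl; exact hks hi) (hmax i hi)⟩)
    have hne : ∀ i ∈ s, i ≠ k := by rintro i hi rfl; exact hks hi
    refine ⟨S', φ', Function.update c k c', ?_, hS', ?_, ?_⟩
    · intro i
      by_cases h : i = k
      · subst h; simpa using hc'
      · simpa [h] using hc i
    · rw [Finset.sum_insert hks, Function.update_self, Finset.sum_congr rfl
        (fun i hi => Function.update_of_ne (hne i hi) c' c)]
      linarith
    · intro i hi
      rcases Finset.mem_insert.1 hi with rfl | hi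
      · rw [Function.update_self]; exact ⟨a, b, hout'⟩
      · rw [Function.update_of_ne (hne i hi)]; exact hout i hi

/-- A finite family of sets, each weighted by a bound for its diameter, that covers `P`. -/
def IsWeightedCover {H : Type*} [PseudoMetricSpace H] (T : Finset (Set H × ℝ)) (P : Set H) : Prop :=
  (∀ U ∈ T, 0 ≤ U.2 ∧ ∀ z ∈ U.1, ∀ w ∈ U.1, dist z w ≤ U.2) ∧ ∀ z ∈ P, ∃ U ∈ T, z ∈ U.1

lemma IsWeightedCover.filter_inter {H : Type*} [PseudoMetricSpace H] {T : Finset (Set H × ℝ)}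
    {P Q : Set H} (h : IsWeightedCover T P) (hQ : Q ⊆ P) :
    IsWeightedCover (T.filter fun U => (U.1 ∩ Q).Nonempty) Q := by
  refine ⟨fun U hU => h.1 U (Finset.mem_filter.1 hU).1, fun z hz => ?_⟩
  obtain ⟨U, hU, hzU⟩ := h.2 z (hQ hz)
  exact ⟨U, Finset.mem_filter.2 ⟨hU, z, hzU, hz⟩, hzU⟩

/-- `c` bounds from below the cost of every weighted cover of `P`, each set costing its diameter
plus `δ`. -/
def IsCoverBound {H : Type*} [PseudoMetricSpace H] (P : Set H) (δ c : ℝ) : Prop :=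
  ∀ T : Finset (Set H × ℝ), IsWeightedCover T P → c ≤ ∑ U ∈ T, (U.2 + δ)

/-- Merging, from fine to coarse, all sets of a cover that touch a given set `P i` lowers the cost
by at least `g i`; hence the total gain is at most the initial cost. -/
theorem sum_gain_le_cost {ι H : Type*} [PseudoMetricSpace H] {δ : ℝ} (hδ : 0 ≤ δ) {V : Set H}
    {C₀ : Finset (Set H × ℝ)} (hC₀ : IsWeightedCover C₀ V) (hC₀' : ∀ U ∈ C₀, U.2 = 0)
    (s : Finset ι) {P : ι → Set H} {μ D g r : ι → ℝ} (hPV : ∀ i ∈ s, P i ⊆ V)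
    (hμ : ∀ i ∈ s, 0 ≤ μ i) (hD₀ : ∀ i ∈ s, 0 ≤ D i)
    (hD : ∀ i ∈ s, ∀ z ∈ P i, ∀ w ∈ P i, dist z w + 2 * μ i ≤ D i)
    (hsep : ∀ i ∈ s, ∀ j ∈ s, i ≠ j → r i ≤ r j →
      D i ≤ μ j ∨ ∀ z ∈ P i, ∀ w ∈ P j, μ i < dist z w)
    (hgain : ∀ i ∈ s, ∀ T, IsWeightedCover T (P i) → (∀ U ∈ T, U.2 ≤ μ i) →
      D i + δ + g i ≤ ∑ U ∈ T, (U.2 + δ)) :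
    ∑ i ∈ s, g i ≤ ∑ U ∈ C₀, (U.2 + δ) := by
  suffices h : ∃ C, IsWeightedCover C V ∧ (∀ U ∈ C, U.2 = 0 ∨ ∃ k ∈ s, U.2 ≤ D k ∧
      ∀ u ∈ U.1, ∃ z ∈ P k, dist u z ≤ μ k) ∧
      ∑ i ∈ s, g i + ∑ U ∈ C, (U.2 + δ) ≤ ∑ U ∈ C₀, (U.2 + δ) by
    obtain ⟨C, hC, -, hsum⟩ := h
    have : 0 ≤ ∑ U ∈ C, (U.2 + δ) := Finset.sum_nonneg fun U hU => add_nonneg (hC.1 U hU).1 hδ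
    linarith
  induction s using Finset.induction_on_max_value r with
  | empty => exact ⟨C₀, hC₀, fun U hU => Or.inl (hC₀' U hU), by simp⟩
  | insert k s hks hmax ih =>
    have hsub : ∀ {i}, i ∈ s → i ∈ insert k s := fun hi => Finset.mem_insert_of_mem hi
    have hk := Finset.mem_insert_self k s
    obtain ⟨C, hC, hlab, hsum⟩ := ih (fun i hi => hPV i (hsub hi)) (fun i hi => hμ i (hsub hi))
      (fun i hi => hD₀ i (hsub hi)) (fun i hi => hD i (hsub hi))
      (fun i hi j hj => hsep i (hsub hi) j (hsub hj)) (fun i hi => hgain i (hsub hi))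
    set T := C.filter fun U => (U.1 ∩ P k).Nonempty with hT
    have hTsmall : ∀ U ∈ T, U.2 ≤ μ k := by
      intro U hU
      obtain ⟨hUC, u, huU, huP⟩ := Finset.mem_filter.1 hU
      rcases hlab U hUC with h | ⟨i, his, hi1, hi2⟩
      · rw [h]; exact hμ k hk
      · rcases hsep i (hsub his) k hk (by rintro rfl; exact hks his) (hmax i his) with h | h
        · exact hi1.trans h
        · obtain ⟨z, hz, hz2⟩ := hi2 u huU
          have := h z hz u huP
          rw [dist_comm] at this
          linarith
    have hTcov : IsWeightedCover T (P k) := hC.filter_inter (hPV k hk)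
    set U₀ : Set H × ℝ := (P k ∪ ⋃ U ∈ T, U.1, D k) with hU₀
    have hnear : ∀ u ∈ U₀.1, ∃ z ∈ P k, dist u z ≤ μ k := by
      rintro u (hu | hu)
      · exact ⟨u, hu, by rw [dist_self]; exact hμ k hk⟩
      · simp only [mem_iUnion] at hu
        obtain ⟨U, hU, huU⟩ := hu
        obtain ⟨hUC, z, hzU, hzP⟩ := Finset.mem_filter.1 hU
        exact ⟨z, hzP, ((hC.1 U hUC).2 u huU z hzU).trans (hTsmall U hU)⟩
    refine ⟨insert U₀ (C.filter fun U => ¬ (U.1 ∩ P k).Nonempty), ⟨?_, ?_⟩, ?_, ?_⟩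
    · intro U hU
      rcases Finset.mem_insert.1 hU with rfl | hU
      · refine ⟨hD₀ k hk, fun z hz w hw => ?_⟩
        obtain ⟨z', hz', hzz⟩ := hnear z hz
        obtain ⟨w', hw', hww⟩ := hnear w hw
        have := hD k hk z' hz' w' hw'
        have := dist_triangle4 z z' w' w
        rw [dist_comm w' w] at this
        change dist z w ≤ D k
        linarith
      · exact hC.1 U (Finset.mem_filter.1 hU).1
    · intro z hz
      obtain ⟨U, hU, hzU⟩ := hC.2 z hz
      by_cases h : (U.1 ∩ P k).Nonempty
      · refine ⟨U₀, Finset.mem_insert_self _ _, Or.inr ?_⟩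
        exact mem_biUnion (Finset.mem_filter.2 ⟨hU, h⟩ : U ∈ T) hzU
      · exact ⟨U, Finset.mem_insert_of_mem (Finset.mem_filter.2 ⟨hU, h⟩), hzU⟩
    · intro U hU
      rcases Finset.mem_insert.1 hU with rfl | hU
      · exact Or.inr ⟨k, hk, le_rfl, hnear⟩
      · rcases hlab U (Finset.mem_filter.1 hU).1 with h | ⟨i, hi, h⟩
        · exact Or.inl h
        · exact Or.inr ⟨i, hsub hi, h⟩
    · have h1 := hgain k hk T hTcov hTsmall
      have h2 : ∑ U ∈ insert U₀ (C.filter fun U => ¬ (U.1 ∩ P k).Nonempty), (U.2 + δ)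
          ≤ (D k + δ) + ∑ U ∈ C.filter (fun U => ¬ (U.1 ∩ P k).Nonempty), (U.2 + δ) := by
        by_cases h : U₀ ∈ C.filter fun U => ¬ (U.1 ∩ P k).Nonempty
        · rw [Finset.insert_eq_of_mem h]
          linarith [hD₀ k hk]
        · rw [Finset.sum_insert h]
      have h3 := Finset.sum_filter_add_sum_filter_not C (fun U => (U.1 ∩ P k).Nonempty)
        (fun U => U.2 + δ)
      rw [Finset.sum_insert hks]
      linarith

/-- Covering sets too small to touch two of the pieces `P i` pay for each piece separately. -/
lemma sum_le_cost_of_separated {κ H : Type*} [PseudoMetricSpace H] {δ μ : ℝ} (hδ : 0 ≤ δ)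
    (s : Finset κ) {P : κ → Set H} {c : κ → ℝ} {Q : Set H} (hPQ : ∀ i ∈ s, P i ⊆ Q)
    (hc : ∀ i ∈ s, IsCoverBound (P i) δ (c i))
    (hsep : ∀ i ∈ s, ∀ j ∈ s, i ≠ j → ∀ z ∈ P i, ∀ w ∈ P j, μ < dist z w)
    {T : Finset (Set H × ℝ)} (hT : IsWeightedCover T Q) (hTμ : ∀ U ∈ T, U.2 ≤ μ) :
    ∑ i ∈ s, c i ≤ ∑ U ∈ T, (U.2 + δ) := by
  have hdisj : (s : Set κ).PairwiseDisjoint fun i => T.filter fun U => (U.1 ∩ P i).Nonempty := by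
    intro i hi j hj hij
    rw [Function.onFun, Finset.disjoint_left]
    intro U hU hU'
    obtain ⟨hUT, z, hz, hzP⟩ := Finset.mem_filter.1 hU
    obtain ⟨-, w, hw, hwP⟩ := Finset.mem_filter.1 hU'
    have := hsep i hi j hj hij z hzP w hwP
    linarith [(hT.1 U hUT).2 z hz w hw, hTμ U hUT]
  calc ∑ i ∈ s, c i ≤ ∑ i ∈ s, ∑ U ∈ T.filter (fun U => (U.1 ∩ P i).Nonempty), (U.2 + δ) :=
        Finset.sum_le_sum fun i hi => hc i hi _ (hT.filter_inter (hPQ i hi))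
    _ = ∑ U ∈ s.biUnion fun i => T.filter fun U => (U.1 ∩ P i).Nonempty, (U.2 + δ) :=
        (Finset.sum_biUnion hdisj).symm
    _ ≤ ∑ U ∈ T, (U.2 + δ) := by
        refine Finset.sum_le_sum_of_subset_of_nonneg ?_ fun U hU _ =>
          add_nonneg (hT.1 U hU).1 hδ
        exact Finset.biUnion_subset.2 fun i _ => Finset.filter_subset _ _

/-- A set whose image under a `1`-Lipschitz function is `δ`-dense in `[α, ω)` has cover bound
`ω - α`. -/
lemma isCoverBound_of_dense_image {H : Type*} [PseudoMetricSpace H] {P : Set H} {δ α ω : ℝ}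
    (hδ : 0 ≤ δ) (f : H → ℝ) (hf : ∀ z w, f z - f w ≤ dist z w)
    (hP : ∀ s, α ≤ s → s < ω → ∃ z ∈ P, f z ≤ s ∧ s ≤ f z + δ) : IsCoverBound P δ (ω - α) := by
  intro T hT
  have hsub : Ico α ω ⊆ ⋃ U ∈ T, Icc (sInf (f '' U.1)) (sInf (f '' U.1) + (U.2 + δ)) := by
    intro s hs
    obtain ⟨z, hz, h1, h2⟩ := hP s hs.1 hs.2
    obtain ⟨U, hU, hzU⟩ := hT.2 z hz
    have hlow : ∀ v ∈ f '' U.1, f z - U.2 ≤ v := by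
      rintro _ ⟨w, hw, rfl⟩
      linarith [hf z w, (hT.1 U hU).2 z hzU w hw]
    have h3 : sInf (f '' U.1) ≤ f z := csInf_le ⟨_, hlow⟩ ⟨z, hzU, rfl⟩
    have h4 : f z - U.2 ≤ sInf (f '' U.1) := le_csInf ⟨_, z, hzU, rfl⟩ hlow
    refine mem_biUnion hU ⟨by linarith, by linarith⟩
  have hnn : ∀ U ∈ T, 0 ≤ U.2 + δ := fun U hU => add_nonneg (hT.1 U hU).1 hδ
  have hvol : ENNReal.ofReal (ω - α) ≤ ENNReal.ofReal (∑ U ∈ T, (U.2 + δ)) := by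
    rw [← Real.volume_Ico, ENNReal.ofReal_sum_of_nonneg hnn]
    refine (measure_mono hsub).trans ((measure_biUnion_finset_le _ _).trans_eq ?_)
    refine Finset.sum_congr rfl fun U _ => ?_
    rw [Real.volume_Icc, add_sub_cancel_left]
  exact (ENNReal.ofReal_le_ofReal_iff (Finset.sum_nonneg hnn)).1 hvol

/-- A discrete intermediate value theorem along a chain with steps at most `δ`. -/
lemma exists_chain_value {H : Type*} [PseudoMetricSpace H] {p : ℕ → H} {N : ℕ} {δ : ℝ}
    (hstep : ∀ j < N, dist (p j) (p (j + 1)) ≤ δ) (f : H → ℝ)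
    (hf : ∀ z w, f z - f w ≤ dist z w) {a b : ℕ} (ha : a ≤ N) (hb : b ≤ N) {s : ℝ}
    (has : f (p a) ≤ s) (hbs : s < f (p b)) :
    ∃ j, min a b ≤ j ∧ j ≤ max a b ∧ f (p j) ≤ s ∧ s ≤ f (p j) + δ := by
  rcases le_total a b with hab | hab
  · obtain ⟨j, hj, hmax⟩ := ((Finset.Icc a b).filter fun j => f (p j) ≤ s).exists_max_image id
      ⟨a, by simp [hab, has]⟩
    simp only [Finset.mem_filter, Finset.mem_Icc, id] at hj hmax
    have hjb : j < b := lt_of_le_of_ne hj.1.2 (by rintro rfl; linarith)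
    refine ⟨j, by omega, by omega, hj.2, ?_⟩
    have h1 : s < f (p (j + 1)) := by
      by_contra! h
      have := hmax (j + 1) ⟨⟨by omega, by omega⟩, h⟩
      omega
    have := hf (p (j + 1)) (p j)
    rw [dist_comm] at this
    linarith [hstep j (by omega)]
  · obtain ⟨j, hj, hmin⟩ := ((Finset.Icc b a).filter fun j => f (p j) ≤ s).exists_min_image id
      ⟨a, by simp [hab, has]⟩
    simp only [Finset.mem_filter, Finset.mem_Icc, id] at hj hmin
    have hjb : b < j := lt_of_le_of_ne hj.1.1 (by rintro rfl; linarith)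
    obtain ⟨i, rfl⟩ : ∃ i, j = i + 1 := ⟨j - 1, by omega⟩
    refine ⟨i + 1, by omega, by omega, hj.2, ?_⟩
    have h1 : s < f (p i) := by
      by_contra! h
      have := hmin i ⟨⟨by omega, by omega⟩, h⟩
      omega
    linarith [hstep i (by omega), hf (p i) (p (i + 1))]

/-- A chain leaving the ball `B(y,ρ)` costs at least `ρ` to cover inside it. -/
lemma isCoverBound_ball {H : Type*} [PseudoMetricSpace H] {p : ℕ → H} {N : ℕ} {δ ρ : ℝ}
    (hδ : 0 ≤ δ) (hstep : ∀ j < N, dist (p j) (p (j + 1)) ≤ δ) {a b : ℕ} (ha : a ≤ N) (hb : b ≤ N)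
    (hab : ρ ≤ dist (p b) (p a)) :
    IsCoverBound {z | (∃ j ≤ N, p j = z) ∧ dist z (p a) < ρ} δ ρ := by
  have hf : ∀ z w, dist z (p a) - dist w (p a) ≤ dist z w := fun z w => by
    linarith [dist_triangle z w (p a)]
  rw [← sub_zero ρ]
  refine isCoverBound_of_dense_image hδ (fun z => dist z (p a)) hf fun s hs hsρ => ?_
  obtain ⟨j, -, hj, h1, h2⟩ := exists_chain_value hstep (fun z => dist z (p a)) hf ha hb
    (s := s) (by simpa using hs) (by linarith)
  exact ⟨p j, ⟨⟨j, by omega, rfl⟩, by linarith⟩, h1, h2⟩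

/-- Many separated points of a chain in a common ball make covers expensive. -/
lemma card_mul_le_cost {H : Type*} [PseudoMetricSpace H] {p : ℕ → H} {N : ℕ} {δ r μ : ℝ}
    (hδ : 0 ≤ δ) (hr : 0 < r) (hμ : μ ≤ r / 4) (hstep : ∀ j < N, dist (p j) (p (j + 1)) ≤ δ)
    (X : Finset H) (hX : 2 ≤ X.card) (hXp : ∀ x ∈ X, ∃ j ≤ N, p j = x)
    (hsep : ∀ x ∈ X, ∀ y ∈ X, x ≠ y → r ≤ dist x y) {T : Finset (Set H × ℝ)}
    (hT : IsWeightedCover T {z | (∃ j ≤ N, p j = z) ∧ ∃ x ∈ X, dist z x < r / 4})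
    (hTμ : ∀ U ∈ T, U.2 ≤ μ) : X.card * (r / 4) ≤ ∑ U ∈ T, (U.2 + δ) := by
  have := sum_le_cost_of_separated (μ := μ) hδ X (c := fun _ => r / 4)
    (P := fun x => {z | (∃ j ≤ N, p j = z) ∧ dist z x < r / 4}) ?_ ?_ ?_ hT hTμ
  · simpa using this
  · rintro x hx z ⟨hz, hzx⟩
    exact ⟨hz, x, hx, hzx⟩
  · intro x hx
    obtain ⟨y, hy, hyx⟩ := Finset.exists_mem_ne (show 1 < X.card by omega) x
    obtain ⟨a, ha, rfl⟩ := hXp x hx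
    obtain ⟨b, hb, rfl⟩ := hXp y hy
    exact isCoverBound_ball hδ hstep ha hb (by linarith [hsep _ hy _ hx hyx])
  · rintro x hx y hy hxy z ⟨-, hz⟩ w ⟨-, hw⟩
    have := hsep x hx y hy hxy
    have := dist_triangle4 x z w y
    rw [dist_comm x z] at this
    linarith

/-- If a flat arc crosses a ball and the chain also has a point far from the line of the arc, then
covers of the chain near that ball cost definitely more than the diameter. -/
lemma IsFlatArc.exists_expensive {H : Type*} [NormedAddCommGroup H] [InnerProductSpace ℝ H]
    {p : ℕ → H} {N : ℕ} {δ R h μ ω : ℝ} {t a b j₀ : ℕ} (hδ : 0 ≤ δ)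
    (hstep : ∀ j < N, dist (p j) (p (j + 1)) ≤ δ)
    (harc : IsFlatArc p N (p t) t (2 * R) h a b) (hj₀ : j₀ ≤ N)
    (hfar : ω ≤ infDist (p j₀) (lineThrough (p a) (p b - p a)))
    (hnear : dist (p j₀) (p t) + ω / 2 ≤ R) (hω : 0 < ω) (hh : h ≤ ω / 100) (hh0 : 0 ≤ h)
    (hμ : μ ≤ ω / 100) (hδω : δ ≤ ω / 100) :
    ∃ P : Set H, P ⊆ {z | ∃ j ≤ N, p j = z} ∧ (∀ z ∈ P, dist z (p t) ≤ R + 4 * h) ∧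
      ∀ T, IsWeightedCover T P → (∀ U ∈ T, U.2 ≤ μ) →
        (2 * R + 8 * h + 2 * μ) + δ + ω / 4 ≤ ∑ U ∈ T, (U.2 + δ) := by
  obtain ⟨hat, htb, hbN, haR, hbR, harc⟩ := harc
  have hR : ω / 2 ≤ R := by linarith [dist_nonneg (x := p j₀) (y := p t)]
  obtain ⟨q, hq, hxq⟩ := (harc t hat htb).2
  have hseg : ∀ z ∈ segment ℝ (p a) (p b), ∃ θ ∈ Icc (0 : ℝ) 1, z = p a + θ • (p b - p a) := by
    intro z hz
    rw [segment_eq_image'] at hz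
    obtain ⟨θ, hθ, rfl⟩ := hz
    exact ⟨θ, hθ, rfl⟩
  obtain ⟨θ, hθ, hqθ⟩ := hseg q hq
  set w := p b - p a with hw
  have hda : dist (p a) q = θ * ‖w‖ := by
    rw [hqθ, dist_eq_norm, sub_add_cancel_left, norm_neg, norm_smul, Real.norm_of_nonneg hθ.1]
  have hdb : dist (p b) q = (1 - θ) * ‖w‖ := by
    have : p b - q = (1 - θ) • w := by rw [hqθ, hw]; module
    rw [dist_eq_norm, this, norm_smul, Real.norm_of_nonneg (by linarith [hθ.2])]
  have ha' : 2 * R - h < θ * ‖w‖ := by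
    have := dist_triangle_right (p a) (p t) q
    linarith
  have hb' : 2 * R - h < (1 - θ) * ‖w‖ := by
    have := dist_triangle_right (p b) (p t) q
    linarith
  have hw0 : 0 < ‖w‖ := by linarith
  set u := ‖w‖⁻¹ • w with hu
  have hu1 : ‖u‖ = 1 := by
    rw [hu, norm_smul, norm_inv, norm_norm, inv_mul_cancel₀ hw0.ne']
  have hwu : inner ℝ w u = ‖w‖ := by
    rw [hu, inner_smul_right, real_inner_self_eq_norm_sq]
    field_simp
  have hin : ∀ v : H, |inner ℝ v u| ≤ ‖v‖ := fun v => by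
    simpa [hu1] using abs_real_inner_le_norm v u
  set f : H → ℝ := fun z => inner ℝ (z - p t) u with hf
  have hflip : ∀ z z', f z - f z' ≤ dist z z' := by
    intro z z'
    rw [hf, dist_eq_norm]
    simp only
    rw [← inner_sub_left, sub_sub_sub_cancel_right]
    exact (le_abs_self _).trans (hin _)
  have hdec : ∀ z (θ' : ℝ), f z
      = inner ℝ (z - (p a + θ' • w)) u + (θ' - θ) * ‖w‖ + inner ℝ (q - p t) u := by
    intro z θ'
    rw [← hwu, ← real_inner_smul_left, ← inner_add_left, ← inner_add_left]
    simp only [hf]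
    congr 1
    rw [hqθ]; module
  have hqt : |inner ℝ (q - p t) u| ≤ h := (hin _).trans (by rwa [← dist_eq_norm, dist_comm])
  have hfa : f (p a) ≤ -R := by
    have := hdec (p a) 0
    simp only [zero_smul, add_zero, sub_self, inner_zero_left, zero_sub, neg_mul] at this
    linarith [le_abs_self (inner ℝ (q - p t) u)]
  have hfb : R ≤ f (p b) := by
    have := hdec (p b) 1
    simp only [one_smul, hw, add_sub_cancel, sub_self, inner_zero_left, zero_add] at this
    rw [← hw] at this
    linarith [neg_abs_le (inner ℝ (q - p t) u)]
  have hμ' : μ < ω / 2 - h := by linarith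
  set P₁ : Set H := {z | (∃ j, a ≤ j ∧ j ≤ b ∧ p j = z) ∧ -R ≤ f z ∧ f z ≤ R} with hP₁
  set P₂ : Set H := {z | (∃ j ≤ N, p j = z) ∧ dist z (p j₀) < ω / 2} with hP₂
  have hb₁ : IsCoverBound P₁ δ (R - (-R + δ)) := by
    refine isCoverBound_of_dense_image hδ f hflip fun s hs hsR => ?_
    obtain ⟨j, h1, h2, h3, h4⟩ := exists_chain_value hstep f hflip (a := a) (b := b) (s := s)
      (by omega) hbN (by linarith) (by linarith)
    exact ⟨p j, ⟨⟨j, by omega, by omega, rfl⟩, by linarith, by linarith⟩, h3, h4⟩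
  have hline : ∀ z ∈ segment ℝ (p a) (p b), ω ≤ dist (p j₀) z := by
    intro z hz
    obtain ⟨θ', -, h1⟩ := hseg z hz
    exact hfar.trans (infDist_le_dist_of_mem ⟨θ', h1⟩)
  have hb₂ : IsCoverBound P₂ δ (ω / 2) := by
    refine isCoverBound_ball hδ hstep hj₀ (b := t) (by omega) ?_
    have := dist_triangle (p j₀) (p t) q
    rw [dist_comm (p j₀) (p t)] at this
    linarith [hline q hq]
  refine ⟨P₁ ∪ P₂, ?_, ?_, ?_⟩
  · rintro z (⟨⟨j, -, h2, rfl⟩, -⟩ | ⟨h, -⟩)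
    · exact ⟨j, by omega, rfl⟩
    · exact h
  · rintro z (⟨⟨j, h1, h2, rfl⟩, h3, h4⟩ | ⟨-, hz⟩)
    · obtain ⟨q', hq', hd⟩ := (harc j h1 h2).2
      obtain ⟨θ', -, rfl⟩ := hseg q' hq'
      have h5 := hdec (p j) θ'
      have h6 : |inner ℝ (p j - (p a + θ' • w)) u| ≤ h := (hin _).trans (by rwa [← dist_eq_norm])
      have h7 : dist (p a + θ' • w) q = |(θ' - θ) * ‖w‖| := by
        rw [hqθ, dist_add_left, dist_eq_norm, ← sub_smul, norm_smul, abs_mul, abs_norm,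
          Real.norm_eq_abs]
      have h8 : |(θ' - θ) * ‖w‖| ≤ R + 2 * h := by
        rw [abs_le] at *
        constructor <;> linarith [hqt.1, hqt.2, h6.1, h6.2]
      have h9 := dist_triangle4 (p j) (p a + θ' • w) q (p t)
      rw [dist_comm q] at h9
      linarith
    · have := dist_triangle z (p j₀) (p t)
      linarith
  · intro T hT hTμ
    have := sum_le_cost_of_separated (μ := μ) hδ Finset.univ (Q := P₁ ∪ P₂)
      (P := fun c : Bool => if c then P₁ else P₂)
      (c := fun c : Bool => if c then R - (-R + δ) else ω / 2) ?_ ?_ ?_ hT hTμ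
    · rw [Fintype.sum_bool] at this
      simp only [if_true, Bool.false_eq_true, if_false] at this
      linarith
    · rintro (_ | _) -
      · exact subset_union_right
      · exact subset_union_left
    · rintro (_ | _) -
      · exact hb₂
      · exact hb₁
    · have key : ∀ z ∈ P₁, ∀ v ∈ P₂, μ < dist z v := by
        rintro z ⟨⟨j, h1, h2, rfl⟩, -⟩ v ⟨-, hv⟩
        obtain ⟨q', hq', hd⟩ := (harc j h1 h2).2
        have h3 := hline q' hq'
        have h4 := dist_triangle4 (p j₀) v (p j) q'
        rw [dist_comm (p j₀) v, dist_comm v (p j)] at h4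
        linarith
      rintro (_ | _) - (_ | _) - hne z hz v hv
      · exact absurd rfl hne
      · rw [dist_comm]; exact key v hv z hz
      · exact key z hz v hv
      · exact absurd rfl hne

/-- A finite family of sets on dyadic scales, separated on each scale, whose covers are expensive,
has total gain at most the cost of the chain, up to the number of scales that must be skipped. -/
theorem sum_gain_le_of_scales {ι H : Type*} [PseudoMetricSpace H] {p : ℕ → H} {N J : ℕ} {δ : ℝ}
    (hδ : 0 ≤ δ) (hJ : 0 < J) (s : Finset ι) (k : ι → ℤ) {P : ι → Set H} {D g : ι → ℝ} {μ D₀ : ℝ}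
    (hP : ∀ i ∈ s, P i ⊆ {z | ∃ j ≤ N, p j = z}) (hμ : 0 ≤ μ) (hJμ : D₀ ≤ 2 ^ J * μ)
    (hD₀ : ∀ i ∈ s, 0 ≤ D i) (hD : ∀ i ∈ s, D i ≤ D₀ * 2 ^ (-k i))
    (hPD : ∀ i ∈ s, ∀ z ∈ P i, ∀ w ∈ P i, dist z w + 2 * (μ * 2 ^ (-k i)) ≤ D i)
    (hsep : ∀ i ∈ s, ∀ j ∈ s, i ≠ j → k i = k j → ∀ z ∈ P i, ∀ w ∈ P j,
      μ * 2 ^ (-k i) < dist z w)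
    (hgain : ∀ i ∈ s, ∀ T, IsWeightedCover T (P i) → (∀ U ∈ T, U.2 ≤ μ * 2 ^ (-k i)) →
      D i + δ + g i ≤ ∑ U ∈ T, (U.2 + δ)) :
    ∑ i ∈ s, g i ≤ J * ((N + 1) * δ) := by
  have hmaps : ∀ i ∈ s, (k i % (J : ℤ)).toNat ∈ Finset.range J := fun i _ => by
    have h1 := Int.emod_nonneg (k i) (show (J : ℤ) ≠ 0 by omega)
    have h2 := Int.emod_lt_of_pos (k i) (show (0 : ℤ) < J by omega)
    rw [Finset.mem_range]
    omega
  rw [← Finset.sum_fiberwise_of_maps_to hmaps]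
  refine (Finset.sum_le_card_nsmul _ _ ((N + 1) * δ) fun c _ => ?_).trans (by simp)
  let C₀ : Finset (Set H × ℝ) := (Finset.range (N + 1)).image fun j => ({p j}, 0)
  have hC₀' : ∀ U ∈ C₀, U.2 = 0 := by
    intro U hU
    obtain ⟨j, -, rfl⟩ := Finset.mem_image.1 hU
    rfl
  have hC₀ : IsWeightedCover C₀ {z | ∃ j ≤ N, p j = z} := by
    refine ⟨fun U hU => ⟨(hC₀' U hU).ge, ?_⟩, ?_⟩
    · obtain ⟨j, -, rfl⟩ := Finset.mem_image.1 hU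
      rintro z rfl w rfl
      simp
    · rintro _ ⟨j, hj, rfl⟩
      exact ⟨_, Finset.mem_image_of_mem _ (Finset.mem_range.2 (Nat.lt_succ_of_le hj)), rfl⟩
  have hcost : ∑ U ∈ C₀, (U.2 + δ) ≤ (N + 1) * δ := by
    have hcard : (C₀.card : ℝ) ≤ N + 1 := by
      have := Finset.card_image_le (s := Finset.range (N + 1))
        (f := fun j => (({p j} : Set H), (0 : ℝ)))
      rw [Finset.card_range] at this
      exact_mod_cast this
    rw [Finset.sum_congr rfl fun U hU => by rw [hC₀' U hU, zero_add], Finset.sum_const,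
      nsmul_eq_mul]
    gcongr
  refine le_trans ?_ hcost
  have hpos : ∀ i, (0 : ℝ) < 2 ^ (-k i) := fun i => by positivity
  refine sum_gain_le_cost hδ hC₀ hC₀' _ (P := P) (μ := fun i => μ * 2 ^ (-k i)) (D := D)
    (r := fun i => 2 ^ (-k i)) ?_ ?_ ?_ ?_ ?_ ?_
  · exact fun i hi => hP i (Finset.mem_filter.1 hi).1
  · exact fun i _ => mul_nonneg hμ (hpos i).le
  · exact fun i hi => hD₀ i (Finset.mem_filter.1 hi).1
  · exact fun i hi => hPD i (Finset.mem_filter.1 hi).1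
  · intro i hi j hj hij hr
    rw [Finset.mem_filter] at hi hj
    have hkk : k j ≤ k i := by
      have := (zpow_le_zpow_iff_right₀ (one_lt_two : (1 : ℝ) < 2)).1 hr
      omega
    rcases hkk.eq_or_lt with h | h
    · exact Or.inr (hsep i hi.1 j hj.1 hij h.symm)
    · left
      have hmod : k i % (J : ℤ) = k j % (J : ℤ) := by
        have h1 := Int.emod_nonneg (k i) (show (J : ℤ) ≠ 0 by omega)
        have h2 := Int.emod_nonneg (k j) (show (J : ℤ) ≠ 0 by omega)
        omega
      have hle : (J : ℤ) ≤ k i - k j :=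
        Int.le_of_dvd (by omega) (Int.ModEq.dvd hmod.symm)
      have hscale : (2 : ℝ) ^ J * 2 ^ (-k i) ≤ 2 ^ (-k j) := by
        rw [← zpow_natCast, ← zpow_add₀ two_ne_zero]
        exact zpow_le_zpow_right₀ one_le_two (by omega)
      calc D i ≤ D₀ * 2 ^ (-k i) := hD i hi.1
        _ ≤ 2 ^ J * μ * 2 ^ (-k i) := by gcongr
        _ = μ * (2 ^ J * 2 ^ (-k i)) := by ring
        _ ≤ μ * 2 ^ (-k j) := by gcongr
  · exact fun i hi => hgain i (Finset.mem_filter.1 hi).1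

lemma sum_zpow_neg_le (K : Finset ℤ) (a : ℤ) (ha : ∀ k ∈ K, a ≤ k) :
    ∑ k ∈ K, (2 : ℝ) ^ (-k) ≤ 2 * 2 ^ (-a) := by
  induction K using Finset.induction_on_min generalizing a with
  | empty => simp; positivity
  | insert b s hb ih =>
    rw [Finset.sum_insert fun h => lt_irrefl _ (hb b h)]
    have h1 := ih (b + 1) fun k hk => hb k hk
    have h2 : (2 : ℝ) ^ (-b) = 2 * 2 ^ (-(b + 1)) := by
      rw [neg_add, zpow_add₀ two_ne_zero]
      norm_num
      ring
    have h3 : (2 : ℝ) ^ (-b) ≤ 2 ^ (-a) :=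
      zpow_le_zpow_right₀ one_le_two (neg_le_neg (ha b (Finset.mem_insert_self _ _)))
    linarith

lemma sum_zpow_neg_le_of_le (K : Finset ℤ) {d : ℝ} (hd : 0 ≤ d)
    (h : ∀ k ∈ K, (2 : ℝ) ^ (-k) ≤ d) : ∑ k ∈ K, (2 : ℝ) ^ (-k) ≤ 2 * d := by
  rcases K.eq_empty_or_nonempty with rfl | hK
  · simpa using hd
  · exact (sum_zpow_neg_le K _ fun k hk => K.min'_le k hk).trans
      (mul_le_mul_of_nonneg_left (h _ (K.min'_mem hK)) zero_le_two)

/-- At most one term per dyadic scale, bounded by the scale and by `d ^ 2` over the scale. -/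
lemma sum_le_of_injOn_scale {ι : Type*} (s : Finset ι) (k : ι → ℤ) (hk : Set.InjOn k s) {d : ℝ}
    (hd : 0 ≤ d) {b : ι → ℝ} (hb0 : ∀ i ∈ s, 0 ≤ b i) (hb1 : ∀ i ∈ s, b i ≤ 1)
    (hbd : ∀ i ∈ s, b i * 2 ^ (-k i) ≤ d) :
    ∑ i ∈ s, b i ^ 2 * 2 ^ (-k i) ≤ 4 * d := by
  have hpos : ∀ i, (0 : ℝ) < 2 ^ (-k i) := fun i => by positivity
  rcases hd.eq_or_lt with rfl | hd'
  · refine (Finset.sum_nonpos fun i hi => ?_).trans (by simp)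
    nlinarith [hb0 i hi, hbd i hi]
  rw [← Finset.sum_filter_add_sum_filter_not s fun i => (2 : ℝ) ^ (-k i) ≤ d]
  have h1 : ∑ i ∈ s with (2 : ℝ) ^ (-k i) ≤ d, b i ^ 2 * 2 ^ (-k i) ≤ 2 * d := by
    have := sum_zpow_neg_le_of_le ((s.filter fun i => (2 : ℝ) ^ (-k i) ≤ d).image k) hd
      (by
        simp only [Finset.mem_image, Finset.mem_filter, forall_exists_index, and_imp]
        rintro _ i - h rfl
        exact h)
    rw [Finset.sum_image (hk.mono fun i hi => (Finset.mem_filter.1 hi).1)] at this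
    refine (Finset.sum_le_sum fun i hi => ?_).trans this
    have hi := (Finset.mem_filter.1 hi).1
    exact mul_le_of_le_one_left (hpos i).le (pow_le_one₀ (hb0 i hi) (hb1 i hi))
  have h2 : ∑ i ∈ s with ¬(2 : ℝ) ^ (-k i) ≤ d, b i ^ 2 * 2 ^ (-k i) ≤ 2 * d := by
    have := sum_zpow_neg_le_of_le ((s.filter fun i => ¬(2 : ℝ) ^ (-k i) ≤ d).image fun i => -k i)
      (d := d⁻¹) (by positivity) (by
        simp only [Finset.mem_image, Finset.mem_filter, not_le, forall_exists_index, and_imp]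
        rintro _ i - h rfl
        rw [zpow_neg]
        exact inv_anti₀ hd' h.le)
    rw [Finset.sum_image fun i hi j hj h =>
      hk (Finset.mem_filter.1 hi).1 (Finset.mem_filter.1 hj).1 (neg_injective h)] at this
    calc _ ≤ ∑ i ∈ s with ¬(2 : ℝ) ^ (-k i) ≤ d, d ^ 2 * 2 ^ (-(-k i)) := by
          refine Finset.sum_le_sum fun i hi => ?_
          have hi := (Finset.mem_filter.1 hi).1
          rw [zpow_neg _ (-k i), ← div_eq_mul_inv, le_div_iff₀ (hpos i)]
          have := pow_le_pow_left₀ (mul_nonneg (hb0 i hi) (hpos i).le) (hbd i hi) 2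
          nlinarith
      _ ≤ d ^ 2 * (2 * d⁻¹) := by
          rw [← Finset.mul_sum]
          gcongr
      _ = 2 * d := by field_simp
  linarith

/-- Flat items of comparable beta number, on an arbitrary set of scales. -/
lemma sum_le_of_flat_level {ι H : Type*} [NormedAddCommGroup H] [InnerProductSpace ℝ H]
    {p : ℕ → H} {N : ℕ} {δ A : ℝ} (hA : 1 < A) (hδ : 0 ≤ δ)
    (hstep : ∀ j < N, dist (p j) (p (j + 1)) ≤ δ) (s : Finset ι) (k : ι → ℤ) (t : ι → ℕ)
    (β h : ι → ℝ) (m : ℕ) (hlow : ∀ i ∈ s, (1 / 2) ^ (m + 1) < β i)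
    (hup : ∀ i ∈ s, β i ≤ 1)
    (hfar : ∀ i ∈ s, ∀ a v : H, ∃ j ≤ N, dist (p j) (p (t i)) ≤ A * 2 ^ (-k i) + δ ∧
      A * β i * 2 ^ (-k i) / 2 ≤ infDist (p j) (lineThrough a v))
    (hδs : ∀ i ∈ s, δ ≤ A * β i * 2 ^ (-k i) / 1000)
    (hsep : ∀ i ∈ s, ∀ j ∈ s, i ≠ j → k i = k j →
      16 * A * 2 ^ (-k i) ≤ dist (p (t i)) (p (t j)))
    (hh0 : ∀ i ∈ s, 0 ≤ h i) (hh : ∀ i ∈ s, h i ≤ A * β i * 2 ^ (-k i) / 200)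
    (harc : ∀ i ∈ s, ∃ a b,
      IsFlatArc p N (p (t i)) (t i) (2 * (2 * (A * 2 ^ (-k i)))) (h i) a b) :
    ∑ i ∈ s, A * β i * 2 ^ (-k i) / 8 ≤ (m + 11) * ((N + 1) * δ) := by
  have hpos : ∀ i, (0 : ℝ) < 2 ^ (-k i) := fun i => by positivity
  have hβ0 : ∀ i ∈ s, 0 < β i := fun i hi => lt_trans (by positivity) (hlow i hi)
  have hArpos : ∀ i, (0 : ℝ) < A * 2 ^ (-k i) := fun i => mul_pos (by linarith) (hpos i)
  have hω : ∀ i ∈ s, 0 < A * β i * 2 ^ (-k i) := fun i hi =>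
    mul_pos (mul_pos (by linarith) (hβ0 i hi)) (hpos i)
  have hω1 : ∀ i ∈ s, A * β i * 2 ^ (-k i) ≤ A * 2 ^ (-k i) := fun i hi => by
    nlinarith [hArpos i, hup i hi]
  have hμ : ∀ i ∈ s, A * (1 / 2) ^ (m + 1) / 200 * 2 ^ (-k i) ≤ A * β i * 2 ^ (-k i) / 200 :=
    fun i hi => by nlinarith [hArpos i, hlow i hi]
  have key : ∀ i ∈ s, ∃ P : Set H, P ⊆ {z | ∃ j ≤ N, p j = z} ∧
      (∀ z ∈ P, dist z (p (t i)) ≤ 2 * (A * 2 ^ (-k i)) + 4 * h i) ∧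
      ∀ T, IsWeightedCover T P →
        (∀ U ∈ T, U.2 ≤ A * (1 / 2) ^ (m + 1) / 200 * 2 ^ (-k i)) →
        (2 * (2 * (A * 2 ^ (-k i))) + 8 * h i + 2 * (A * (1 / 2) ^ (m + 1) / 200 * 2 ^ (-k i))) +
          δ + (A * β i * 2 ^ (-k i) / 2) / 4 ≤ ∑ U ∈ T, (U.2 + δ) := by
    intro i hi
    obtain ⟨a, b, hab⟩ := harc i hi
    obtain ⟨j, hj, hjx, hj'⟩ := hfar i hi (p a) (p b - p a)
    refine hab.exists_expensive hδ hstep hj hj' ?_ ?_ ?_ (hh0 i hi) ?_ ?_ <;>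
      linarith [hω i hi, hω1 i hi, hδs i hi, hh i hi, hμ i hi]
  choose! P hP1 hP2 hP3 using key
  have h2J : 5 * A ≤ 2 ^ (m + 11) * (A * (1 / 2) ^ (m + 1) / 200) := by
    have : (2 : ℝ) ^ (m + 11) * (1 / 2) ^ (m + 1) = 1024 := by
      rw [show m + 11 = (m + 1) + 10 by ring, pow_add, mul_right_comm, ← mul_pow]
      norm_num
    rw [show (2 : ℝ) ^ (m + 11) * (A * (1 / 2) ^ (m + 1) / 200) =
      2 ^ (m + 11) * (1 / 2) ^ (m + 1) * A / 200 by ring, this]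
    linarith
  have hμ0 : 0 ≤ A * (1 / 2) ^ (m + 1) / 200 := by positivity
  have := sum_gain_le_of_scales (J := m + 11) hδ (by omega) s k (P := P)
    (D := fun i => 2 * (2 * (A * 2 ^ (-k i))) + 8 * h i +
      2 * (A * (1 / 2) ^ (m + 1) / 200 * 2 ^ (-k i)))
    (g := fun i => (A * β i * 2 ^ (-k i) / 2) / 4) hP1 hμ0 h2J ?_ ?_ ?_ ?_ hP3
  · refine le_trans (Finset.sum_le_sum fun i _ => ?_) (this.trans (by push_cast; rfl))
    linarith
  · intro i hi
    nlinarith [hh0 i hi, hArpos i, mul_nonneg hμ0 (hpos i).le]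
  · intro i hi
    linarith [hω i hi, hω1 i hi, hh i hi, hμ i hi, hArpos i]
  · intro i hi z hz w hw
    linarith [dist_triangle_right z w (p (t i)), hP2 i hi z hz, hP2 i hi w hw]
  · intro i hi j hj hij hk z hz w hw
    have h1 := hP2 i hi z hz
    have h2 := hP2 j hj w hw
    have h3 := hsep i hi j hj hij hk
    have h4 := hh i hi
    have h5 := hh j hj
    have h6 := hω1 i hi
    have h7 := hω1 j hj
    have h8 := hArpos i
    have h9 := hμ i hi
    rw [← hk] at h2 h5 h7
    linarith [dist_triangle4 (p (t i)) z w (p (t j)), dist_comm z (p (t i))]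

/-- The sum over the levels of beta numbers. -/
lemma exists_level_sum_const : ∃ K : ℝ, 0 < K ∧ ∀ M : Finset ℕ,
    ∑ m ∈ M, (m + 11 : ℝ) * (1 / 2) ^ m ≤ K := by
  have hs : Summable fun m : ℕ => (m + 11 : ℝ) * (1 / 2) ^ m := by
    have h1 : Summable fun m : ℕ => (m : ℝ) * (1 / 2) ^ m := by
      simpa using summable_pow_mul_geometric_of_norm_lt_one 1 (r := (1 / 2 : ℝ)) (by norm_num)
    have h2 := (summable_geometric_of_lt_one (r := (1 / 2 : ℝ)) (by norm_num) (by norm_num)).mul_left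
      11
    exact (h1.add h2).congr fun m => by ring
  refine ⟨∑' m : ℕ, (m + 11 : ℝ) * (1 / 2) ^ m, hs.tsum_pos (fun m => by positivity) 0 (by simp),
    fun M => hs.sum_le_tsum M fun m _ => by positivity⟩

/-- Items far from the ends of the chain, separated on each scale. -/
theorem exists_sum_le_of_far (A : ℝ) (hA : 1 < A) : ∃ C : ℝ, 0 < C ∧
    ∀ {ι H : Type*} [NormedAddCommGroup H] [InnerProductSpace ℝ H]
    {p : ℕ → H} {N : ℕ} {δ : ℝ} (_ : 0 ≤ δ)
    (_ : ∀ j < N, dist (p j) (p (j + 1)) ≤ δ) (_ : p N = p 0) (s : Finset ι) (k : ι → ℤ)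
    (t : ι → ℕ) (β : ι → ℝ) (_ : ∀ i ∈ s, t i ≤ N) (_ : ∀ i ∈ s, 0 < β i) (_ : ∀ i ∈ s, β i ≤ 1)
    (_ : ∀ i ∈ s, ∀ a v : H, ∃ j ≤ N, dist (p j) (p (t i)) ≤ A * 2 ^ (-k i) + δ ∧
      A * β i * 2 ^ (-k i) / 2 ≤ infDist (p j) (lineThrough a v))
    (_ : ∀ i ∈ s, δ ≤ A * β i * 2 ^ (-k i) / 1000)
    (_ : ∀ i ∈ s, ∀ j ∈ s, i ≠ j → k i = k j →
      16 * A * 2 ^ (-k i) ≤ dist (p (t i)) (p (t j)))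
    (_ : ∀ i ∈ s, 4 * (A * 2 ^ (-k i)) < dist (p 0) (p (t i))),
    ∑ i ∈ s, β i ^ 2 * 2 ^ (-k i) ≤ C * ((N + 1) * δ) := by
  obtain ⟨K, hK, hKM⟩ := exists_level_sum_const
  refine ⟨16000000 + 8 * K, by positivity, ?_⟩
  intro ι H _ _ p N δ hδ hstep hclosed s k t β htN hβ0 hβ1 hfar hδs hsep hends
  have hpos : ∀ i, (0 : ℝ) < 2 ^ (-k i) := fun i => by positivity
  have hArpos : ∀ i, (0 : ℝ) < A * 2 ^ (-k i) := fun i => mul_pos (by linarith) (hpos i)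
  have hL : 0 ≤ (N + 1) * δ := by positivity
  have hlen : ∑ j ∈ Finset.range N, dist (p j) (p (j + 1)) ≤ (N + 1) * δ := by
    refine (Finset.sum_le_card_nsmul _ _ δ fun j hj => hstep j (Finset.mem_range.1 hj)).trans ?_
    rw [Finset.card_range, nsmul_eq_mul]
    exact mul_le_mul_of_nonneg_right (by linarith) hδ
  have hscale : ∀ i ∈ s, δ ≤ A * 2 ^ (-k i) / 1000 := fun i hi => by
    nlinarith [hδs i hi, hArpos i, hβ1 i hi]
  have hmaps : ∀ i ∈ s, (k i % 4).toNat ∈ Finset.range 4 := fun i _ => by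
    rw [Finset.mem_range]
    omega
  have hclass : ∀ c : ℕ, ∃ γ : ι → ℝ, (∀ i, 0 ≤ γ i) ∧
      ∑ i ∈ s with (k i % 4).toNat = c, γ i ≤ 2 * ((N + 1) * δ) ∧
      ∀ i ∈ s.filter (fun i => (k i % 4).toNat = c), ∃ a b,
        IsFlatArc p N (p (t i)) (t i) (2 * (2 * (A * 2 ^ (-k i))))
          √(12 * (2 * (2 * (A * 2 ^ (-k i)))) * γ i) a b := by
    intro c
    refine (exists_flatArcs (p := p) (N := N) (t := t)
      (x := fun i => p (t i)) (R := fun i => 2 * (2 * (A * 2 ^ (-k i))))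
      (s.filter fun i => (k i % 4).toNat = c) ?_ ?_ ?_ ?_ ?_ ?_ ?_).imp
        fun γ hγ => ⟨hγ.1, hγ.2.1.trans (by linarith), hγ.2.2⟩
    · exact fun i _ => by linarith [hArpos i]
    · exact fun i hi => htN i (Finset.mem_filter.1 hi).1
    · exact fun i _ => rfl
    · exact fun i hi => by linarith [hends i (Finset.mem_filter.1 hi).1]
    · exact fun i hi => by rw [hclosed]; linarith [hends i (Finset.mem_filter.1 hi).1]
    · exact fun i hi j hj => by
        linarith [hscale i (Finset.mem_filter.1 hi).1, hstep j hj, hArpos i]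
    · intro i hi j hj hij hR
      rw [Finset.mem_filter] at hi hj
      have hr : (2 : ℝ) ^ (-k i) ≤ 2 ^ (-k j) := by
        by_contra! h
        have := mul_lt_mul_of_pos_left h (show 0 < A by linarith)
        linarith
      have hkk : k j ≤ k i := by
        have := (zpow_le_zpow_iff_right₀ (one_lt_two : (1 : ℝ) < 2)).1 hr
        omega
      rcases hkk.eq_or_lt with h | h
      · right
        have := hsep i hi.1 j hj.1 hij h.symm
        rw [h]
        linarith
      · left
        have h16 : 16 * (2 : ℝ) ^ (-k i) ≤ 2 ^ (-k j) := by
          rw [show (16 : ℝ) = 2 ^ (4 : ℤ) by norm_num, ← zpow_add₀ two_ne_zero]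
          exact zpow_le_zpow_right₀ one_le_two (by omega)
        nlinarith [hArpos i]
  choose γ hγ0 hγs hγ using hclass
  let c : ι → ℝ := fun i => γ (k i % 4).toNat i
  have hc0 : ∀ i, 0 ≤ c i := fun i => hγ0 _ i
  have hcs : ∑ i ∈ s, c i ≤ 8 * ((N + 1) * δ) := by
    rw [← Finset.sum_fiberwise_of_maps_to hmaps]
    refine (Finset.sum_le_card_nsmul _ _ (2 * ((N + 1) * δ)) fun m _ => ?_).trans
      (by rw [Finset.card_range, nsmul_eq_mul]; push_cast; linarith)
    refine le_of_eq_of_le (Finset.sum_congr rfl fun i hi => ?_) (hγs m)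
    simp only [c, (Finset.mem_filter.1 hi).2]
  have harc : ∀ i ∈ s, ∃ a b, IsFlatArc p N (p (t i)) (t i) (2 * (2 * (A * 2 ^ (-k i))))
      √(12 * (2 * (2 * (A * 2 ^ (-k i)))) * c i) a b := fun i hi =>
    hγ _ i (Finset.mem_filter.2 ⟨hi, rfl⟩)
  let h : ι → ℝ := fun i => √(12 * (2 * (2 * (A * 2 ^ (-k i)))) * c i)
  rw [← Finset.sum_filter_add_sum_filter_not s fun i => h i ≤ A * β i * 2 ^ (-k i) / 200]
  have hflat : ∑ i ∈ s with h i ≤ A * β i * 2 ^ (-k i) / 200, β i ^ 2 * 2 ^ (-k i) ≤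
      8 * K * ((N + 1) * δ) := by
    have hlev : ∀ i ∈ s, ∃ m : ℕ, (1 / 2 : ℝ) ^ (m + 1) < β i ∧ β i ≤ (1 / 2) ^ m := fun i hi =>
      exists_nat_pow_near_of_lt_one (hβ0 i hi) (hβ1 i hi) (by norm_num) (by norm_num)
    choose! m hm1 hm2 using hlev
    set s' := s.filter fun i => h i ≤ A * β i * 2 ^ (-k i) / 200 with hs'
    rw [← Finset.sum_fiberwise_of_maps_to (g := m) (t := s'.image m)
      fun i hi => Finset.mem_image_of_mem _ hi]
    calc _ ≤ ∑ l ∈ s'.image m, ((l + 11 : ℝ) * (1 / 2) ^ l) * (8 * ((N + 1) * δ)) := by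
          refine Finset.sum_le_sum fun l _ => ?_
          have hmem : ∀ i ∈ s'.filter (fun i => m i = l),
              i ∈ s ∧ h i ≤ A * β i * 2 ^ (-k i) / 200 ∧ m i = l := fun i hi => by
            simpa [hs', and_assoc] using hi
          have := sum_le_of_flat_level hA hδ hstep (s'.filter fun i => m i = l) k t β h l
            (fun i hi => (hmem i hi).2.2 ▸ hm1 i (hmem i hi).1)
            (fun i hi => hβ1 i (hmem i hi).1) (fun i hi => hfar i (hmem i hi).1)
            (fun i hi => hδs i (hmem i hi).1)
            (fun i hi j hj => hsep i (hmem i hi).1 j (hmem j hj).1)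
            (fun i _ => Real.sqrt_nonneg _) (fun i hi => (hmem i hi).2.1)
            (fun i hi => harc i (hmem i hi).1)
          calc _ ≤ ∑ i ∈ s' with m i = l, (8 * (1 / 2) ^ l) * (A * β i * 2 ^ (-k i) / 8) := by
                refine Finset.sum_le_sum fun i hi => ?_
                have h1 : β i ≤ (1 / 2) ^ l := (hmem i hi).2.2 ▸ hm2 i (hmem i hi).1
                have h2 := hβ0 i (hmem i hi).1
                have h3 : β i ^ 2 ≤ (1 / 2) ^ l * (A * β i) := by
                  rw [sq]
                  exact mul_le_mul h1 (by nlinarith) h2.le (by positivity)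
                nlinarith [mul_le_mul_of_nonneg_right h3 (hpos i).le]
            _ = (8 * (1 / 2) ^ l) * ∑ i ∈ s' with m i = l, (A * β i * 2 ^ (-k i) / 8) := by
                rw [Finset.mul_sum]
            _ ≤ (8 * (1 / 2) ^ l) * ((l + 11) * ((N + 1) * δ)) := by gcongr
            _ = _ := by ring
      _ ≤ K * (8 * ((N + 1) * δ)) := by
          rw [← Finset.sum_mul]
          gcongr
          exact hKM _
      _ = _ := by ring
  have hbent : ∑ i ∈ s with ¬h i ≤ A * β i * 2 ^ (-k i) / 200, β i ^ 2 * 2 ^ (-k i) ≤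
      2000000 * (8 * ((N + 1) * δ)) := by
    calc _ ≤ ∑ i ∈ s with ¬h i ≤ A * β i * 2 ^ (-k i) / 200, 2000000 * c i := by
          refine Finset.sum_le_sum fun i hi => ?_
          obtain ⟨hi, hlt⟩ := Finset.mem_filter.1 hi
          rw [not_le, Real.lt_sqrt (by have := hβ0 i hi; positivity)] at hlt
          have h1 : A * (β i ^ 2 * 2 ^ (-k i)) ≤ 1920000 * c i := by
            by_contra! hcon
            have := mul_lt_mul_of_pos_left hcon (hArpos i)
            nlinarith
          have h2 : β i ^ 2 * 2 ^ (-k i) ≤ A * (β i ^ 2 * 2 ^ (-k i)) :=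
            le_mul_of_one_le_left (by positivity) hA.le
          linarith [hc0 i]
      _ ≤ 2000000 * ∑ i ∈ s, c i := by
          rw [← Finset.mul_sum]
          gcongr
          · exact fun i _ _ => hc0 i
          · exact Finset.filter_subset _ _
      _ ≤ _ := by gcongr
  linarith

/-- A greedy choice of representatives, by decreasing value of `β`. -/
lemma exists_greedy_representatives {ι : Type*} (s : Finset ι) (β : ι → ℝ) {r : ι → ι → Prop}
    (hrefl : ∀ i, r i i) (hsymm : ∀ i j, r i j → r j i) :
    ∃ Y ⊆ s, ∃ π : ι → ι, (∀ i ∈ s, π i ∈ Y ∧ r i (π i) ∧ β i ≤ β (π i)) ∧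
      ∀ y ∈ Y, ∀ y' ∈ Y, y ≠ y' → ¬r y y' := by
  induction s using Finset.induction_on_min_value β with
  | empty => exact ⟨∅, by simp, id, by simp, by simp⟩
  | insert a s has hmin ih =>
    obtain ⟨Y, hYs, π, hπ, hY⟩ := ih
    by_cases h : ∃ y ∈ Y, r a y
    · obtain ⟨y, hy, hay⟩ := h
      refine ⟨Y, hYs.trans (Finset.subset_insert _ _), Function.update π a y, ?_, hY⟩
      intro i hi
      rcases Finset.mem_insert.1 hi with rfl | hi'
      · simpa using ⟨hy, hay, hmin y (hYs hy)⟩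
      · rw [Function.update_of_ne (by rintro rfl; exact has hi')]
        exact hπ i hi'
    · push Not at h
      refine ⟨insert a Y, Finset.insert_subset_insert _ hYs, Function.update π a a, ?_, ?_⟩
      · intro i hi
        rcases Finset.mem_insert.1 hi with rfl | hi'
        · simpa using hrefl i
        · rw [Function.update_of_ne (by rintro rfl; exact has hi')]
          exact ⟨Finset.mem_insert_of_mem (hπ i hi').1, (hπ i hi').2⟩
      · intro y hy y' hy' hne
        rcases Finset.mem_insert.1 hy with rfl | hyY <;>
          rcases Finset.mem_insert.1 hy' with rfl | hyY'
        · exact absurd rfl hne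
        · exact h y' hyY'
        · exact fun hr => h y hyY (hsymm _ _ hr)
        · exact hY y hyY y' hyY' hne

/-- Clusters with many points. -/
theorem exists_sum_card_le_of_large (A : ℝ) (hA : 1 < A) : ∃ C : ℝ, 0 < C ∧
    ∀ {ι H : Type*} [PseudoMetricSpace H] {p : ℕ → H} {N : ℕ} {δ : ℝ} (_ : 0 ≤ δ)
    (_ : ∀ j < N, dist (p j) (p (j + 1)) ≤ δ) (s Y : Finset ι) (k : ι → ℤ) (t : ι → ℕ) (π : ι → ι)
    (_ : ∀ i ∈ s, t i ≤ N)
    (_ : ∀ i ∈ s, ∀ j ∈ s, i ≠ j → k i = k j → (2 : ℝ) ^ (-k i) ≤ dist (p (t i)) (p (t j)))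
    (_ : ∀ i ∈ s, k i = k (π i) ∧ dist (p (t i)) (p (t (π i))) ≤ 16 * A * 2 ^ (-k i))
    (_ : ∀ y ∈ Y, δ ≤ 2 ^ (-k y) / 100)
    (_ : ∀ y ∈ Y, 360 * A < (s.filter fun i => π i = y).card),
    ∑ y ∈ Y, ((s.filter fun i => π i = y).card : ℝ) * 2 ^ (-k y) ≤ C * ((N + 1) * δ) := by
  obtain ⟨J, hJ⟩ := pow_unbounded_of_one_lt (264 * A) (one_lt_two : (1 : ℝ) < 2)
  have hJ0 : 0 < J := by
    rcases Nat.eq_zero_or_pos J with rfl | h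
    · rw [pow_zero] at hJ
      linarith
    · exact h
  refine ⟨10 * J, by positivity, ?_⟩
  intro ι H _ p N δ hδ hstep s Y k t π htN hsep hπ hδr hlarge
  have hpos : ∀ i, (0 : ℝ) < 2 ^ (-k i) := fun i => by positivity
  have hArpos : ∀ i, (2 : ℝ) ^ (-k i) < A * 2 ^ (-k i) := fun i => by nlinarith [hpos i]
  let X : ι → Finset H := fun y => (s.filter fun i => π i = y).image fun i => p (t i)
  have hXcard : ∀ y, (X y).card = (s.filter fun i => π i = y).card := fun y => by
    refine Finset.card_image_of_injOn fun i hi j hj hij => ?_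
    rw [Finset.mem_coe, Finset.mem_filter] at hi hj
    by_contra hne
    have := hsep i hi.1 j hj.1 hne (by rw [(hπ i hi.1).1, (hπ j hj.1).1, hi.2, hj.2])
    rw [show p (t i) = p (t j) from hij, dist_self] at this
    exact absurd this (not_le.2 (hpos i))
  have hX : ∀ y, ∀ x ∈ X y, ∃ i ∈ s, π i = y ∧ k i = k y ∧ p (t i) = x ∧
      dist x (p (t y)) ≤ 16 * A * 2 ^ (-k y) := fun y x hx => by
    obtain ⟨i, hi, rfl⟩ := Finset.mem_image.1 hx
    rw [Finset.mem_filter] at hi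
    have := hπ i hi.1
    rw [this.1, hi.2] at this
    exact ⟨i, hi.1, hi.2, (hπ i hi.1).1.trans (by rw [hi.2]), rfl, this.2⟩
  have := sum_gain_le_of_scales hδ hJ0 Y k (p := p) (N := N)
    (P := fun y => {z | (∃ j ≤ N, p j = z) ∧ ∃ x ∈ X y, dist z x < 2 ^ (-k y) / 4})
    (D := fun y => 33 * A * 2 ^ (-k y)) (D₀ := 33 * A) (μ := 1 / 8)
    (g := fun y => ((s.filter fun i => π i = y).card : ℝ) * 2 ^ (-k y) / 10)
    (fun y _ z hz => hz.1) (by norm_num) (by linarith) (fun y _ => by have := hpos y; positivity)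
    (fun y _ => le_rfl) ?_ ?_ ?_
  · rw [← Finset.sum_div] at this
    linarith
  · rintro y - z ⟨-, x, hx, hzx⟩ w ⟨-, x', hx', hwx⟩
    obtain ⟨-, -, -, -, -, h1⟩ := hX y x hx
    obtain ⟨-, -, -, -, -, h2⟩ := hX y x' hx'
    linarith [dist_triangle4 z x x' w, dist_triangle_right x x' (p (t y)), dist_comm w x', hArpos y,
      hpos y]
  · rintro y - y' - hne hk z ⟨-, x, hx, hzx⟩ w ⟨-, x', hx', hwx⟩
    obtain ⟨i, hi, hiy, hik, rfl, -⟩ := hX y x hx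
    obtain ⟨j, hj, hjy, hjk, rfl, -⟩ := hX y' x' hx'
    have := hsep i hi j hj (by rintro rfl; exact hne (hiy.symm.trans hjy))
      (by rw [hik, hjk, hk])
    rw [hik] at this
    rw [← hk] at hwx
    linarith [dist_triangle4 (p (t i)) z w (p (t j)), dist_comm z (p (t i)), hpos y]
  · intro y hy T hT hTμ
    have hl := hlarge y hy
    have h2 : 2 ≤ (X y).card := by
      rw [hXcard]
      have : (1 : ℝ) < (s.filter fun i => π i = y).card := by linarith
      exact_mod_cast this
    have h3 := card_mul_le_cost hδ (hpos y) (μ := 1 / 8 * 2 ^ (-k y)) (by linarith [hpos y]) hstep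
      (X y) h2 (fun x hx => by
        obtain ⟨i, hi, -, -, rfl, -⟩ := hX y x hx
        exact ⟨t i, htN i hi, rfl⟩) (fun x hx x' hx' hne => by
        obtain ⟨i, hi, -, hik, rfl, -⟩ := hX y x hx
        obtain ⟨j, hj, -, hjk, rfl, -⟩ := hX y x' hx'
        rw [← hik]
        exact hsep i hi j hj (by rintro rfl; exact hne rfl) (by rw [hik, hjk])) hT hTμ
    rw [hXcard] at h3
    have h4 := mul_lt_mul_of_pos_right hl (hpos y)
    linarith [hδr y hy, hArpos y]

/-- The discrete estimate: beta numbers of points of a closed chain. -/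
theorem exists_sum_sq_le (A : ℝ) (hA : 1 < A) : ∃ C : ℝ, 0 < C ∧
    ∀ {ι H : Type*} [NormedAddCommGroup H] [InnerProductSpace ℝ H]
    {p : ℕ → H} {N : ℕ} {δ d : ℝ} (_ : 0 ≤ δ)
    (_ : ∀ j < N, dist (p j) (p (j + 1)) ≤ δ) (_ : p N = p 0) (_ : 0 ≤ d)
    (s : Finset ι) (k : ι → ℤ) (t : ι → ℕ) (β : ι → ℝ) (_ : ∀ i ∈ s, t i ≤ N)
    (_ : ∀ i ∈ s, 0 < β i) (_ : ∀ i ∈ s, β i ≤ 1) (_ : ∀ i ∈ s, β i * 2 ^ (-k i) ≤ d)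
    (_ : ∀ i ∈ s, ∀ a v : H, ∃ j ≤ N, dist (p j) (p (t i)) ≤ A * 2 ^ (-k i) + δ ∧
      A * β i * 2 ^ (-k i) / 2 ≤ infDist (p j) (lineThrough a v))
    (_ : ∀ i ∈ s, δ ≤ A * β i * 2 ^ (-k i) / 1000) (_ : ∀ i ∈ s, δ ≤ 2 ^ (-k i) / 100)
    (_ : ∀ i ∈ s, ∀ j ∈ s, i ≠ j → k i = k j → (2 : ℝ) ^ (-k i) ≤ dist (p (t i)) (p (t j))),
    ∑ i ∈ s, β i ^ 2 * 2 ^ (-k i) ≤ C * ((N + 1) * δ + d) := by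
  obtain ⟨C₁, hC₁, hlarge⟩ := exists_sum_card_le_of_large A hA
  obtain ⟨C₂, hC₂, hsmall⟩ := exists_sum_le_of_far A hA
  have hA0 : 0 < A := by linarith
  refine ⟨C₁ + 360 * A * (C₂ + 4), by positivity, ?_⟩
  intro ι H _ _ p N δ d hδ hstep hclosed hd s k t β htN hβ0 hβ1 hβd hfar hδs hδr hsep
  have hpos : ∀ i, (0 : ℝ) < 2 ^ (-k i) := fun i => by positivity
  obtain ⟨Y, hYs, π, hπ, hY⟩ := exists_greedy_representatives s β
    (r := fun i j => k i = k j ∧ dist (p (t i)) (p (t j)) ≤ 16 * A * 2 ^ (-k i))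
    (fun i => ⟨rfl, by rw [dist_self]; have := hpos i; positivity⟩)
    (fun i j h => ⟨h.1.symm, by rw [← h.1, dist_comm]; exact h.2⟩)
  have hYsep : ∀ y ∈ Y, ∀ y' ∈ Y, y ≠ y' → k y = k y' →
      16 * A * 2 ^ (-k y) < dist (p (t y)) (p (t y')) := fun y hy y' hy' hne hk => by
    by_contra! h
    exact hY y hy y' hy' hne ⟨hk, h⟩
  let n : ι → ℝ := fun y => ((s.filter fun i => π i = y).card : ℝ)
  have hcluster : ∑ i ∈ s, β i ^ 2 * 2 ^ (-k i) ≤ ∑ y ∈ Y, n y * (β y ^ 2 * 2 ^ (-k y)) := by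
    rw [← Finset.sum_fiberwise_of_maps_to (g := π) (t := Y) fun i hi => (hπ i hi).1]
    refine Finset.sum_le_sum fun y _ => ?_
    rw [← nsmul_eq_mul]
    refine Finset.sum_le_card_nsmul _ _ _ fun i hi => ?_
    obtain ⟨his, rfl⟩ := Finset.mem_filter.1 hi
    rw [(hπ i his).2.1.1]
    have := hβ0 i his
    gcongr
    exact (hπ i his).2.2
  refine hcluster.trans ?_
  have hterm : ∀ y, 0 ≤ β y ^ 2 * 2 ^ (-k y) := fun y => mul_nonneg (sq_nonneg _) (hpos y).le
  have hL : 0 ≤ (N + 1) * δ := by positivity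
  rw [← Finset.sum_filter_add_sum_filter_not Y fun y => 360 * A < n y]
  have h1 : ∑ y ∈ Y with 360 * A < n y, n y * (β y ^ 2 * 2 ^ (-k y)) ≤ C₁ * ((N + 1) * δ) := by
    refine le_trans (Finset.sum_le_sum fun y hy => ?_)
      (hlarge hδ hstep s (Y.filter fun y => 360 * A < n y) k t π htN hsep
        (fun i hi => (hπ i hi).2.1) (fun y hy => hδr y (hYs (Finset.mem_filter.1 hy).1))
        fun y hy => (Finset.mem_filter.1 hy).2)
    have hy := hYs (Finset.mem_filter.1 hy).1
    exact mul_le_mul_of_nonneg_left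
      (mul_le_of_le_one_left (hpos y).le (pow_le_one₀ (hβ0 y hy).le (hβ1 y hy))) (Nat.cast_nonneg _)
  have h2 : ∑ y ∈ Y, β y ^ 2 * 2 ^ (-k y) ≤ C₂ * ((N + 1) * δ) + 4 * d := by
    rw [← Finset.sum_filter_add_sum_filter_not Y fun y => 4 * (A * 2 ^ (-k y)) < dist (p 0) (p (t y))]
    refine add_le_add ?_ ?_
    · have hmem : ∀ y ∈ Y.filter (fun y => 4 * (A * 2 ^ (-k y)) < dist (p 0) (p (t y))), y ∈ s :=
        fun y hy => hYs (Finset.mem_filter.1 hy).1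
      exact hsmall hδ hstep hclosed _ k t β (fun y hy => htN y (hmem y hy))
        (fun y hy => hβ0 y (hmem y hy)) (fun y hy => hβ1 y (hmem y hy))
        (fun y hy => hfar y (hmem y hy)) (fun y hy => hδs y (hmem y hy))
        (fun y hy y' hy' hne hk => (hYsep y (Finset.mem_filter.1 hy).1 y'
          (Finset.mem_filter.1 hy').1 hne hk).le) fun y hy => (Finset.mem_filter.1 hy).2
    · have hmem : ∀ y ∈ Y.filter (fun y => ¬4 * (A * 2 ^ (-k y)) < dist (p 0) (p (t y))), y ∈ s :=
        fun y hy => hYs (Finset.mem_filter.1 hy).1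
      refine sum_le_of_injOn_scale _ k ?_ hd (fun y hy => (hβ0 y (hmem y hy)).le)
        (fun y hy => hβ1 y (hmem y hy)) (fun y hy => hβd y (hmem y hy))
      intro y hy y' hy' hk
      rw [Finset.mem_coe, Finset.mem_filter, not_lt] at hy hy'
      by_contra hne
      have h3 := hYsep y hy.1 y' hy'.1 hne hk
      have h4 := hy'.2
      rw [← hk] at h4
      have h5 := mul_pos hA0 (hpos y)
      linarith [dist_triangle_left (p (t y)) (p (t y')) (p 0), hy.2]
  have h3 : ∑ y ∈ Y with ¬360 * A < n y, n y * (β y ^ 2 * 2 ^ (-k y)) ≤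
      360 * A * (C₂ * ((N + 1) * δ) + 4 * d) := by
    calc _ ≤ ∑ y ∈ Y with ¬360 * A < n y, 360 * A * (β y ^ 2 * 2 ^ (-k y)) :=
          Finset.sum_le_sum fun y hy =>
            mul_le_mul_of_nonneg_right (not_lt.1 (Finset.mem_filter.1 hy).2) (hterm y)
      _ ≤ 360 * A * ∑ y ∈ Y, β y ^ 2 * 2 ^ (-k y) := by
          rw [← Finset.mul_sum]
          gcongr
          exact Finset.filter_subset _ _
      _ ≤ _ := by gcongr
  have h4 : 0 ≤ 360 * A * (C₂ * d) := by positivity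
  have h5 : 0 ≤ 360 * A * (4 * ((N + 1) * δ)) := by positivity
  have h6 : 0 ≤ C₁ * d := by positivity
  linarith

/-- A connected set leaving the ball of radius `ρ` about one of its points has length at least `ρ`
in that ball. -/
lemma ofReal_le_hausdorffMeasure_inter_ball {H : Type*} [MetricSpace H] [MeasurableSpace H]
    [BorelSpace H] {Γ : Set H} (hΓ : IsPreconnected Γ) {x y : H} (hx : x ∈ Γ) (hy : y ∈ Γ) {ρ : ℝ}
    (hρ : ρ ≤ dist y x) : ENNReal.ofReal ρ ≤ μH[1] (Γ ∩ ball x ρ) := by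
  have hlip : LipschitzWith 1 fun z => dist z x := LipschitzWith.dist_left x
  have hsub : Ico 0 ρ ⊆ (fun z => dist z x) '' (Γ ∩ ball x ρ) := by
    intro s hs
    obtain ⟨z, hz, rfl⟩ := hΓ.intermediate_value hx hy hlip.continuous.continuousOn
      (show s ∈ Icc (dist x x) (dist y x) from ⟨by simpa using hs.1, hs.2.le.trans hρ⟩)
    exact ⟨z, ⟨hz, hs.2⟩, rfl⟩
  calc ENNReal.ofReal ρ = μH[1] (Ico 0 ρ) := by
        rw [hausdorffMeasure_real, Real.volume_Ico, sub_zero]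
    _ ≤ μH[1] ((fun z => dist z x) '' (Γ ∩ ball x ρ)) := measure_mono hsub
    _ ≤ μH[1] (Γ ∩ ball x ρ) := by
        simpa using hlip.hausdorffMeasure_image_le zero_le_one (Γ ∩ ball x ρ)

lemma dist_le_toReal_hausdorffMeasure {H : Type*} [MetricSpace H] [MeasurableSpace H]
    [BorelSpace H] {Γ : Set H} (hΓ : IsPreconnected Γ) (hfin : μH[1] Γ ≠ ⊤) {x y : H} (hx : x ∈ Γ)
    (hy : y ∈ Γ) : dist x y ≤ (μH[1] Γ).toReal :=
  (ENNReal.ofReal_le_iff_le_toReal hfin).1 <|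
    (ofReal_le_hausdorffMeasure_inter_ball hΓ hy hx le_rfl).trans (measure_mono inter_subset_left)

lemma card_mul_le_hausdorffMeasure {H : Type*} [MetricSpace H] [MeasurableSpace H]
    [BorelSpace H] {Γ : Set H} (hΓ : IsPreconnected Γ) (hΓm : MeasurableSet Γ)
    (hfin : μH[1] Γ ≠ ⊤) {ε : ℝ} (hε : 0 < ε) {u v : H} (hu : u ∈ Γ) (hv : v ∈ Γ)
    (huv : ε ≤ dist u v) (V : Finset H) (hV : ∀ x ∈ V, x ∈ Γ)
    (hsep : ∀ x ∈ V, ∀ y ∈ V, x ≠ y → ε ≤ dist x y) :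
    V.card * ε ≤ 2 * (μH[1] Γ).toReal := by
  have hball : ∀ x ∈ V, ENNReal.ofReal (ε / 2) ≤ μH[1] (Γ ∩ ball x (ε / 2)) := by
    intro x hx
    rcases le_total (ε / 2) (dist u x) with h | h
    · exact ofReal_le_hausdorffMeasure_inter_ball hΓ (hV x hx) hu h
    · exact ofReal_le_hausdorffMeasure_inter_ball hΓ (hV x hx) hv
        (by linarith [dist_triangle_right u v x])
  have hdisj : (V : Set H).PairwiseDisjoint fun x => Γ ∩ ball x (ε / 2) := by
    intro x hx y hy hxy
    refine Disjoint.mono inter_subset_right inter_subset_right (ball_disjoint_ball ?_)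
    linarith [hsep x hx y hy hxy]
  have h : V.card * ENNReal.ofReal (ε / 2) ≤ μH[1] Γ :=
    calc V.card * ENNReal.ofReal (ε / 2) = ∑ _x ∈ V, ENNReal.ofReal (ε / 2) := by simp
      _ ≤ ∑ x ∈ V, μH[1] (Γ ∩ ball x (ε / 2)) := Finset.sum_le_sum hball
      _ = μH[1] (⋃ x ∈ V, Γ ∩ ball x (ε / 2)) :=
          (measure_biUnion_finset hdisj fun x _ => hΓm.inter measurableSet_ball).symm
      _ ≤ μH[1] Γ := measure_mono (iUnion₂_subset fun x _ => inter_subset_left)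
  have := ENNReal.toReal_mono hfin h
  rw [ENNReal.toReal_mul, ENNReal.toReal_natCast, ENNReal.toReal_ofReal (by positivity)] at this
  linarith

lemma exists_maximal_separated {H : Type*} [PseudoMetricSpace H] {Γ : Set H} {ε : ℝ} {B : ℕ}
    (hε : 0 < ε)
    (hB : ∀ V : Finset H, (∀ x ∈ V, x ∈ Γ) → (∀ x ∈ V, ∀ y ∈ V, x ≠ y → ε ≤ dist x y) → V.card ≤ B)
    (n : ℕ) (V : Finset H) (hV : ∀ x ∈ V, x ∈ Γ)
    (hsep : ∀ x ∈ V, ∀ y ∈ V, x ≠ y → ε ≤ dist x y) (hn : B < V.card + n) :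
    ∃ W : Finset H, V ⊆ W ∧ (∀ x ∈ W, x ∈ Γ) ∧ (∀ x ∈ W, ∀ y ∈ W, x ≠ y → ε ≤ dist x y) ∧
      ∀ z ∈ Γ, ∃ w ∈ W, dist z w ≤ ε := by
  induction n generalizing V with
  | zero => exact absurd (hB V hV hsep) (by omega)
  | succ n ih =>
    by_cases h : ∀ z ∈ Γ, ∃ w ∈ V, dist z w ≤ ε
    · exact ⟨V, subset_rfl, hV, hsep, h⟩
    push Not at h
    obtain ⟨z, hz, hzV⟩ := h
    have hzV' : z ∉ V := fun h => by
      have := hzV z h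
      rw [dist_self] at this
      linarith
    have hins : ∀ x ∈ insert z V, ∀ y ∈ insert z V, x ≠ y → ε ≤ dist x y := by
      intro x hx y hy hxy
      rcases Finset.mem_insert.1 hx with rfl | hx' <;> rcases Finset.mem_insert.1 hy with rfl | hy'
      · exact absurd rfl hxy
      · exact (hzV y hy').le
      · exact dist_comm x y ▸ (hzV x hx').le
      · exact hsep x hx' y hy' hxy
    obtain ⟨W, hW, hW'⟩ := ih (insert z V) (by simpa using ⟨hz, hV⟩) hins
      (by rw [Finset.card_insert_of_notMem hzV']; omega)
    exact ⟨W, (Finset.subset_insert _ _).trans hW, hW'⟩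

/-- A finite set connected at scale `η` admits a closed tour with steps at most `η`. -/
lemma exists_closed_tour {H : Type*} [PseudoMetricSpace H] {V : Finset H} {η : ℝ}
    (hconn : ∀ W ⊂ V, W.Nonempty → ∃ w ∈ W, ∃ u ∈ V \ W, dist w u ≤ η) (n : ℕ)
    (hn : n < V.card) :
    ∃ W ⊆ V, W.card = n + 1 ∧ ∃ p : ℕ → H, p (2 * n) = p 0 ∧
      (∀ j < 2 * n, dist (p j) (p (j + 1)) ≤ η) ∧ (∀ j ≤ 2 * n, p j ∈ W) ∧
      ∀ w ∈ W, ∃ j ≤ 2 * n, p j = w := by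
  induction n with
  | zero =>
    obtain ⟨v, hv⟩ := Finset.card_pos.1 hn
    exact ⟨{v}, by simpa using hv, by simp, fun _ => v, rfl, by simp, by simp, by simp⟩
  | succ n ih =>
    obtain ⟨W, hWV, hcard, p, hclosed, hstep, hmem, hhit⟩ := ih (by omega)
    have hne : W ≠ V := by
      rintro rfl
      omega
    obtain ⟨w, hw, u, hu, hwu⟩ := hconn W (Finset.ssubset_iff_subset_ne.2 ⟨hWV, hne⟩)
      (Finset.card_pos.1 (by omega))
    obtain ⟨huV, huW⟩ := Finset.mem_sdiff.1 hu
    obtain ⟨t, ht, rfl⟩ := hhit w hw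
    let q : ℕ → H := fun j => if j ≤ t then p j else if j = t + 1 then u else p (j - 2)
    have hq1 : ∀ j ≤ t, q j = p j := fun j hj => if_pos hj
    have hq2 : q (t + 1) = u := by simp [q]
    have hq3 : ∀ j, t ≤ j → q (j + 2) = p j := fun j hj => by
      simp only [q]
      rw [if_neg (by omega), if_neg (by omega), Nat.add_sub_cancel]
    refine ⟨insert u W, Finset.insert_subset huV hWV,
      by rw [Finset.card_insert_of_notMem huW, hcard], q, ?_, ?_, ?_, ?_⟩
    · rw [hq1 0 (Nat.zero_le _), show 2 * (n + 1) = 2 * n + 2 by ring, hq3 _ ht, hclosed]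
    · intro j hj
      rcases lt_trichotomy j t with h | rfl | h
      · rw [hq1 j h.le, hq1 (j + 1) h]
        exact hstep j (by omega)
      · rwa [hq1 j le_rfl, hq2]
      · rcases (Nat.succ_le_of_lt h).eq_or_lt with rfl | h'
        · rwa [hq2, hq3 t le_rfl, dist_comm]
        · obtain ⟨i, rfl⟩ : ∃ i, j = i + 2 := ⟨j - 2, by omega⟩
          rw [hq3 i (by omega), show i + 2 + 1 = i + 1 + 2 by ring, hq3 (i + 1) (by omega)]
          exact hstep i (by omega)
    · intro j hj
      rcases le_or_gt j t with h | h
      · rw [hq1 j h]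
        exact Finset.mem_insert_of_mem (hmem j (by omega))
      · rcases (Nat.succ_le_of_lt h).eq_or_lt with rfl | h'
        · rw [hq2]
          exact Finset.mem_insert_self _ _
        · obtain ⟨i, rfl⟩ : ∃ i, j = i + 2 := ⟨j - 2, by omega⟩
          rw [hq3 i (by omega)]
          exact Finset.mem_insert_of_mem (hmem i (by omega))
    · intro v hv
      rcases Finset.mem_insert.1 hv with rfl | hv'
      · exact ⟨t + 1, by omega, hq2⟩
      · obtain ⟨j, hj, rfl⟩ := hhit v hv'
        rcases le_total j t with h | h
        · exact ⟨j, by omega, hq1 j h⟩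
        · exact ⟨j + 2, by omega, hq3 j h⟩

/-- A connected compact set of finite length is finely approximated by a closed chain of comparable
length through any prescribed separated set. -/
theorem exists_closed_chain {H : Type*} [MetricSpace H] [MeasurableSpace H]
    [BorelSpace H] {Γ : Set H} (hΓ : IsPreconnected Γ) (hΓm : MeasurableSet Γ)
    (hfin : μH[1] Γ ≠ ⊤) {ε : ℝ} (hε : 0 < ε) {u v : H} (hu : u ∈ Γ) (hv : v ∈ Γ)
    (huv : ε ≤ dist u v) (X : Finset H) (hX : ∀ x ∈ X, x ∈ Γ)
    (hsep : ∀ x ∈ X, ∀ y ∈ X, x ≠ y → ε ≤ dist x y) :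
    ∃ (p : ℕ → H) (N : ℕ), p N = p 0 ∧ (∀ j < N, dist (p j) (p (j + 1)) ≤ 2 * ε) ∧
      (∀ x ∈ X, ∃ j ≤ N, p j = x) ∧ (∀ z ∈ Γ, ∃ j ≤ N, dist z (p j) ≤ ε) ∧
      (N + 1) * (2 * ε) ≤ 8 * (μH[1] Γ).toReal := by
  have hcard := card_mul_le_hausdorffMeasure hΓ hΓm hfin hε hu hv huv
  obtain ⟨B, hB⟩ := exists_nat_ge (2 * (μH[1] Γ).toReal / ε)
  obtain ⟨V, hXV, hVΓ, hVsep, hVnet⟩ := exists_maximal_separated hε (B := B) (fun V h1 h2 => by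
    have := (le_div_iff₀ hε).2 (hcard V h1 h2)
    exact_mod_cast this.trans hB) (B + 1) X hX hsep (by omega)
  have hVne : V.Nonempty := by
    obtain ⟨w, hw, -⟩ := hVnet u hu
    exact ⟨w, hw⟩
  have hconn : ∀ W ⊂ V, W.Nonempty → ∃ w ∈ W, ∃ u ∈ V \ W, dist w u ≤ 2 * ε := by
    intro W hW hWne
    obtain ⟨w₀, hw₀⟩ := hWne
    obtain ⟨u₀, hu₀V, hu₀W⟩ := Finset.exists_of_ssubset hW
    obtain ⟨z, -, hz1, hz2⟩ := isPreconnected_closed_iff.1 hΓ (⋃ w ∈ W, closedBall w ε)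
      (⋃ u ∈ V \ W, closedBall u ε)
      (W.finite_toSet.isClosed_biUnion fun _ _ => isClosed_closedBall)
      ((V \ W).finite_toSet.isClosed_biUnion fun _ _ => isClosed_closedBall)
      (fun z hz => by
        obtain ⟨w, hw, hzw⟩ := hVnet z hz
        by_cases hwW : w ∈ W
        · exact Or.inl (mem_biUnion hwW hzw)
        · exact Or.inr (mem_biUnion (Finset.mem_coe.2 (Finset.mem_sdiff.2 ⟨hw, hwW⟩)) hzw))
      ⟨w₀, hVΓ _ (hW.1 hw₀), mem_biUnion hw₀ (mem_closedBall_self hε.le)⟩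
      ⟨u₀, hVΓ _ hu₀V, mem_biUnion (Finset.mem_coe.2 (Finset.mem_sdiff.2 ⟨hu₀V, hu₀W⟩))
        (mem_closedBall_self hε.le)⟩
    simp only [mem_iUnion, mem_closedBall, exists_prop] at hz1 hz2
    obtain ⟨w, hw, hzw⟩ := hz1
    obtain ⟨u, hu, hzu⟩ := hz2
    exact ⟨w, hw, u, hu, by linarith [dist_triangle_left w u z]⟩
  obtain ⟨W, hWV, hWcard, p, hclosed, hstep, -, hhit⟩ := exists_closed_tour hconn (V.card - 1)
    (Nat.sub_lt hVne.card_pos one_pos)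
  have hpos := hVne.card_pos
  obtain rfl : W = V := Finset.eq_of_subset_of_card_le hWV (by omega)
  refine ⟨p, _, hclosed, hstep, fun x hx => hhit x (hXV hx), fun z hz => ?_, ?_⟩
  · obtain ⟨w, hw, hzw⟩ := hVnet z hz
    obtain ⟨j, hj, rfl⟩ := hhit w hw
    exact ⟨j, hj, hzw⟩
  · have h1 := hcard W hVΓ hVsep
    have h2 : ((2 * (W.card - 1) : ℕ) : ℝ) + 1 ≤ 2 * W.card := by
      exact_mod_cast (by omega : 2 * (W.card - 1) + 1 ≤ 2 * W.card)
    nlinarith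

lemma jonesBeta_nonneg {X : Type*} [NormedAddCommGroup X] [NormedSpace ℝ X] (E Q : Set X) :
    0 ≤ jonesBeta E Q := by
  unfold jonesBeta
  split_ifs
  · exact le_rfl
  · refine Real.sInf_nonneg ?_
    rintro _ ⟨a, v, -, rfl⟩
    refine Real.sSup_nonneg ?_
    rintro _ ⟨z, -, rfl⟩
    exact div_nonneg infDist_nonneg diam_nonneg

lemma mem_lineThrough {X : Type*} [AddCommGroup X] [Module ℝ X] (a v : X) :
    a ∈ lineThrough a v := ⟨0, by simp⟩

lemma lineThrough_zero_subset {X : Type*} [AddCommGroup X] [Module ℝ X] (a w : X) :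
    lineThrough a 0 ⊆ lineThrough a w := by
  rintro _ ⟨s, rfl⟩
  exact ⟨0, by simp⟩

lemma jonesBeta_le {X : Type*} [NormedAddCommGroup X] [NormedSpace ℝ X] [Nontrivial X]
    {E Q : Set X} {a v : X} {τ : ℝ} (hτ : 0 ≤ τ)
    (h : ∀ z ∈ E ∩ Q, infDist z (lineThrough a v) ≤ τ) : jonesBeta E Q ≤ τ / Metric.diam Q := by
  wlog hv : v ≠ 0 generalizing v
  · obtain ⟨w, hw⟩ := exists_ne (0 : X)
    refine this (v := w) (fun z hz => le_trans ?_ (h z hz)) hw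
    rw [not_not.1 hv]
    exact infDist_le_infDist_of_subset (lineThrough_zero_subset a w) ⟨a, mem_lineThrough a 0⟩
  have hτQ : 0 ≤ τ / Metric.diam Q := div_nonneg hτ diam_nonneg
  unfold jonesBeta
  split_ifs
  · exact hτQ
  · refine le_trans (csInf_le ?_ ⟨a, v, hv, rfl⟩) (Real.sSup_le ?_ hτQ)
    · refine ⟨0, ?_⟩
      rintro _ ⟨b, w, -, rfl⟩
      refine Real.sSup_nonneg ?_
      rintro _ ⟨z, -, rfl⟩
      exact div_nonneg infDist_nonneg diam_nonneg
    · rintro _ ⟨z, hz, rfl⟩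
      exact div_le_div_of_nonneg_right (h z hz) diam_nonneg

lemma exists_pos_forall_le {ι : Type*} (s : Finset ι) {f : ι → ℝ} (hf : ∀ i ∈ s, 0 < f i) :
    ∃ ε > 0, ∀ i ∈ s, ε ≤ f i := by
  rcases s.eq_empty_or_nonempty with rfl | hs
  · exact ⟨1, one_pos, by simp⟩
  · obtain ⟨i, hi, hmin⟩ := s.exists_min_image f hs
    exact ⟨f i, hf i hi, hmin⟩

/-- The bound for finitely many balls of a partial multiresolution family. -/
theorem exists_finset_sum_le (A : ℝ) (hA : 1 < A) : ∃ C : ℝ, 0 < C ∧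
    ∀ {H : Type*} [NormedAddCommGroup H] [InnerProductSpace ℝ H] [Nontrivial H]
    [MeasurableSpace H] [BorelSpace H] {Γ E : Set H} {net : ℤ → Set H}
    (_ : IsRectifiableCurve Γ) (_ : E ⊆ Γ) (_ : IsPartialMultiresolution E net)
    (s : Finset (Σ k : ℤ, net k)),
    ∑ i ∈ s, jonesBeta E (closedBall (i.2 : H) (A * 2 ^ (-i.1))) ^ 2 * 2 ^ (-i.1) ≤
      C * (μH[1] Γ).toReal := by
  obtain ⟨C, hC, hmain⟩ := exists_sum_sq_le A hA
  refine ⟨9 * C, by positivity, ?_⟩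
  intro H _ _ _ _ _ Γ E net hΓ hEΓ hnet s
  obtain ⟨⟨f, hf, rfl⟩, hlt⟩ := hΓ
  set Γ := f '' Icc (0 : ℝ) 1
  have hfin := hlt.ne
  have hpre : IsPreconnected Γ := isPreconnected_Icc.image f hf
  have hmeas : MeasurableSet Γ := (isCompact_Icc.image_of_continuousOn hf).isClosed.measurableSet
  set d := (μH[1] Γ).toReal with hd
  have hd0 : 0 ≤ d := ENNReal.toReal_nonneg
  have hdist : ∀ {x y}, x ∈ Γ → y ∈ Γ → dist x y ≤ d := fun hx hy =>
    dist_le_toReal_hausdorffMeasure hpre hfin hx hy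
  let β : (Σ k : ℤ, net k) → ℝ := fun i => jonesBeta E (closedBall (i.2 : H) (A * 2 ^ (-i.1)))
  have hβnn : ∀ i, 0 ≤ β i := fun i => jonesBeta_nonneg _ _
  have hpos : ∀ i : (Σ k : ℤ, net k), (0 : ℝ) < 2 ^ (-i.1) := fun i => by positivity
  have hArpos : ∀ i : (Σ k : ℤ, net k), (2 : ℝ) ^ (-i.1) < A * 2 ^ (-i.1) := fun i => by
    nlinarith [hpos i]
  have hxE : ∀ i : (Σ k : ℤ, net k), (i.2 : H) ∈ E := fun i => hnet.1 i.1 i.2.2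
  have hle : ∀ (i : Σ k : ℤ, net k) (a v : H) (τ : ℝ), 0 ≤ τ →
      (∀ z ∈ E ∩ closedBall (i.2 : H) (A * 2 ^ (-i.1)), infDist z (lineThrough a v) ≤ τ) →
      β i * (2 * (A * 2 ^ (-i.1))) ≤ τ := fun i a v τ hτ h => by
    have hi := hArpos i
    have hi' := hpos i
    have := jonesBeta_le hτ h
    rwa [diam_closedBall_eq _ (by linarith), le_div_iff₀ (by linarith)] at this
  have hβ1 : ∀ i, β i ≤ 1 := fun i => by
    have := hle i i.2 0 (A * 2 ^ (-i.1)) ((hpos i).trans (hArpos i)).le fun z hz =>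
      (infDist_le_dist_of_mem (mem_lineThrough _ _)).trans (mem_closedBall.1 hz.2)
    nlinarith [hArpos i, hpos i]
  have hβd : ∀ i, β i * 2 ^ (-i.1) ≤ d := fun i => by
    have := hle i i.2 0 d hd0 fun z hz =>
      (infDist_le_dist_of_mem (mem_lineThrough _ _)).trans (hdist (hEΓ hz.1) (hEΓ (hxE i)))
    nlinarith [mul_le_mul_of_nonneg_left (hArpos i).le (hβnn i), mul_nonneg (hβnn i) (hpos i).le]
  have hfar : ∀ i, 0 < β i → ∀ a v : H, ∃ z ∈ Γ, dist z i.2 ≤ A * 2 ^ (-i.1) ∧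
      A * β i * 2 ^ (-i.1) < infDist z (lineThrough a v) := fun i hi a v => by
    by_contra! hcon
    have h1 : 0 < A * β i * 2 ^ (-i.1) := mul_pos (mul_pos (by linarith) hi) (hpos i)
    have := hle i a v _ h1.le fun z hz => hcon z (hEΓ hz.1) hz.2
    linarith
  let s' := s.filter fun i => 0 < β i
  have hs' : ∑ i ∈ s', β i ^ 2 * 2 ^ (-i.1) = ∑ i ∈ s, β i ^ 2 * 2 ^ (-i.1) := by
    refine Finset.sum_filter_of_ne fun i _ hi => (hβnn i).lt_of_ne' ?_
    rintro h
    simp [h] at hi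
  change ∑ i ∈ s, β i ^ 2 * 2 ^ (-i.1) ≤ _
  rw [← hs']
  have hβ0 : ∀ i ∈ s', 0 < β i := fun i hi => (Finset.mem_filter.1 hi).2
  rcases s'.eq_empty_or_nonempty with hemp | ⟨i₀, hi₀⟩
  · rw [hemp, Finset.sum_empty]
    positivity
  obtain ⟨u, hu, -, hux⟩ := hfar i₀ (hβ0 i₀ hi₀) i₀.2 0
  have huv : 0 < dist u i₀.2 := by
    refine lt_of_lt_of_le ?_ (infDist_le_dist_of_mem (mem_lineThrough (i₀.2 : H) 0))
    have := mul_pos (mul_pos (show 0 < A by linarith) (hβ0 i₀ hi₀)) (hpos i₀)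
    linarith
  let X : Finset H := s'.image fun i => (i.2 : H)
  obtain ⟨ε₁, hε₁, hε₁s⟩ := exists_pos_forall_le X.offDiag (f := fun q => dist q.1 q.2)
    fun q hq => dist_pos.2 (Finset.mem_offDiag.1 hq).2.2
  obtain ⟨ε₂, hε₂, hε₂s⟩ := exists_pos_forall_le s' (f := fun i => A * β i * 2 ^ (-i.1) / 2000)
    fun i hi => div_pos (mul_pos (mul_pos (by linarith) (hβ0 i hi)) (hpos i)) (by norm_num)
  obtain ⟨ε₃, hε₃, hε₃s⟩ := exists_pos_forall_le s' (f := fun i => (2 : ℝ) ^ (-i.1) / 200)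
    fun i _ => div_pos (hpos i) (by norm_num)
  obtain ⟨ε, hε, hε₁', hε₂', hε₃', hεuv⟩ : ∃ ε > 0, ε ≤ ε₁ ∧ ε ≤ ε₂ ∧ ε ≤ ε₃ ∧ ε ≤ dist u i₀.2 :=
    ⟨min (min ε₁ ε₂) (min ε₃ (dist u i₀.2)),
      lt_min (lt_min hε₁ hε₂) (lt_min hε₃ huv),
      (min_le_left _ _).trans (min_le_left _ _), (min_le_left _ _).trans (min_le_right _ _),
      (min_le_right _ _).trans (min_le_left _ _), (min_le_right _ _).trans (min_le_right _ _)⟩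
  obtain ⟨p, N, hclosed, hstep, hhit, hdense, hlen⟩ := exists_closed_chain hpre hmeas hfin hε hu
    (hEΓ (hxE i₀)) hεuv X
    (fun x hx => by
      obtain ⟨i, -, rfl⟩ := Finset.mem_image.1 hx
      exact hEΓ (hxE i))
    (fun x hx y hy hxy => hε₁'.trans (hε₁s (x, y) (Finset.mem_offDiag.2 ⟨hx, hy, hxy⟩)))
  have hhit' : ∀ i ∈ s', ∃ j ≤ N, p j = i.2 := fun i hi =>
    hhit _ (Finset.mem_image_of_mem _ hi)
  choose! t htN ht using hhit'
  have := hmain (p := p) (N := N) (δ := 2 * ε) (d := d) (by positivity) hstep hclosed hd0 s'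
    (fun i => i.1) t β htN hβ0 (fun i _ => hβ1 i) (fun i _ => hβd i) ?_ ?_ ?_ ?_
  · refine this.trans ?_
    nlinarith
  · intro i hi a v
    obtain ⟨z, hz, hzx, hzl⟩ := hfar i (hβ0 i hi) a v
    obtain ⟨j, hj, hzj⟩ := hdense z hz
    have h2 := hε₂s i hi
    have h3 := infDist_le_infDist_add_dist (s := lineThrough a v) (x := z) (y := p j)
    refine ⟨j, hj, ?_, by linarith⟩
    rw [ht i hi]
    linarith [dist_triangle_left (p j) (i.2 : H) z]
  · intro i hi
    linarith [hε₂s i hi]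
  · intro i hi
    linarith [hε₃s i hi]
  · rintro ⟨k, x⟩ hi ⟨l, y⟩ hj hij hkl
    obtain rfl : k = l := hkl
    rw [ht _ hi, ht _ hj]
    exact hnet.2.2 k x x.2 y y.2 fun h => hij (by rw [Subtype.ext h])

/-- Theorem 1.3(ii): necessary condition in Hilbert space, with exponent `p = 2`. -/
theorem statement5 (A : ℝ) (hA : 1 < A) :
    ∃ C : ℝ, 0 < C ∧
      ∀ (H : Type u) [NormedAddCommGroup H] [InnerProductSpace ℝ H] [CompleteSpace H]
        [MeasurableSpace H] [BorelSpace H] (Γ E : Set H) (net : ℤ → Set H),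
        IsRectifiableCurve Γ → E.Nonempty → E ⊆ Γ → IsPartialMultiresolution E net →
        SEp E net A 2 ≤ ENNReal.ofReal C * μH[1] Γ := by
  obtain ⟨C, hC, hsum⟩ := exists_finset_sum_le A hA
  refine ⟨1 + 2 * A * C, by positivity, ?_⟩
  intro H _ _ _ _ _ Γ E net hΓ _ hEΓ hnet
  set d := (μH[1] Γ).toReal with hd
  have hΓd : μH[1] Γ = ENNReal.ofReal d := (ENNReal.ofReal_toReal hΓ.2.ne).symm
  have hd0 : 0 ≤ d := ENNReal.toReal_nonneg
  have hdiam : Metric.diam E ≤ d := by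
    refine diam_le_of_forall_dist_le hd0 fun x hx y hy => ?_
    obtain ⟨⟨f, hf, rfl⟩, hlt⟩ := hΓ
    exact dist_le_toReal_hausdorffMeasure (isPreconnected_Icc.image f hf) hlt.ne (hEΓ hx) (hEΓ hy)
  have hbeta : betaSum E net A 2 ≤ ENNReal.ofReal (2 * A * C * d) := by
    rw [betaSum, ← ENNReal.tsum_sigma' (fun i : Σ k : ℤ, net k =>
      ENNReal.ofReal (jonesBeta E (closedBall (i.2 : H) (A * (2 : ℝ) ^ (-i.1))) ^ (2 : ℝ) *
        Metric.diam (closedBall (i.2 : H) (A * (2 : ℝ) ^ (-i.1))))), ENNReal.tsum_eq_iSup_sum]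
    refine iSup_le fun s => ?_
    rw [← ENNReal.ofReal_sum_of_nonneg fun i _ =>
      mul_nonneg (Real.rpow_nonneg (jonesBeta_nonneg _ _) _) diam_nonneg]
    refine ENNReal.ofReal_le_ofReal ?_
    rcases subsingleton_or_nontrivial H with hH | hH
    · rw [Finset.sum_eq_zero fun i _ => by rw [diam_subsingleton Set.subsingleton_of_subsingleton,
        mul_zero]]
      positivity
    · calc _ = 2 * A * ∑ i ∈ s,
            jonesBeta E (closedBall (i.2 : H) (A * 2 ^ (-i.1))) ^ 2 * 2 ^ (-i.1) := by
            rw [Finset.mul_sum]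
            refine Finset.sum_congr rfl fun i _ => ?_
            rw [Real.rpow_two, diam_closedBall_eq _ (by positivity)]
            ring
        _ ≤ 2 * A * (C * d) := by
            gcongr
            exact hsum hΓ hEΓ hnet s
        _ = _ := by ring
  calc SEp E net A 2 ≤ ENNReal.ofReal d + ENNReal.ofReal (2 * A * C * d) :=
        add_le_add (ENNReal.ofReal_le_ofReal hdiam) hbeta
    _ = ENNReal.ofReal (1 + 2 * A * C) * μH[1] Γ := by
        rw [hΓd, ← ENNReal.ofReal_add hd0 (by positivity), ← ENNReal.ofReal_mul (by positivity)]
        ring_nf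

end
end

section
/- Let X be a metric space, let ξ > 6, and let r₀ > 0. Let (B(x_i, r_i))_{1 ≤ i < N} be a finite or infinite sequence of closed balls in X (N ∈ ℕ ∪ {∞}, N ≥ 2) and let (k_i)_{1 ≤ i < N} be a sequence of integers bounded from below such that: (i) for every j ≥ 2 with j < N, any two balls in the initial segment {B(x_i, r_i) : 1 ≤ i ≤ j} can be joined by a finite chain of balls from that initial segment in which consecutive balls intersect; (ii) r_i ≤ ξ^{-k_i}·r₀ for all i; (iii) whenever i ≠ j and k_i = k_j = k, gap(B(x_i, r_i), B(x_j, r_j)) ≥ 3·ξ^{-k}·r₀, where gap(S, T) := inf{dist(s, t) : s ∈ S, t ∈ T}. Then there exists a unique index M with k_M = min_i k_i, and ⋃_{1 ≤ i < N} B(x_i, r_i) ⊆ B(x_M, (1 + 3/ξ)·ξ^{-k_M}·r₀). -/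
open Metric Set

universe u

/-- Two indices of level at least `m` whose closed balls intersect. -/
def BallsMeet {X ι : Type*} [PseudoMetricSpace X] (x : ι → X) (r : ι → ℝ) (k : ι → ℤ) (m : ℤ)
    (i j : ι) : Prop :=
  m ≤ k i ∧ m ≤ k j ∧ (closedBall (x i) (r i) ∩ closedBall (x j) (r j)).Nonempty

section BallChains

variable {X ι : Type*} [PseudoMetricSpace X] {x : ι → X} {r : ι → ℝ} {k : ι → ℤ} {a : ℤ → ℝ}

lemma BallsMeet.symm {m : ℤ} {i j : ι} (h : BallsMeet x r k m i j) : BallsMeet x r k m j i :=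
  ⟨h.2.1, h.1, by rw [inter_comm]; exact h.2.2⟩

/-- A ball of level `m` absorbs every ball chained to it through levels at least `m`, provided
chains through levels at least `m + 1` have diameter less than `3 * a (m + 1)`. -/
lemma eq_and_subset_closedBall_of_chain (hpos : ∀ m, 0 < a m) (ha : ∀ m, 6 * a (m + 1) < a m)
    (hr : ∀ i, r i ≤ a (k i))
    (hsep : ∀ i j, i ≠ j → k i = k j →
      ∀ s ∈ closedBall (x i) (r i), ∀ t ∈ closedBall (x j) (r j), 3 * a (k i) ≤ dist s t)
    {m : ℤ}
    (hdiam : ∀ i j, m + 1 ≤ k i → Relation.ReflTransGen (BallsMeet x r k (m + 1)) i j →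
      ∀ p ∈ closedBall (x i) (r i), ∀ q ∈ closedBall (x j) (r j), dist p q < 3 * a (m + 1))
    {M j : ι} (hM : k M = m) (hj : Relation.ReflTransGen (BallsMeet x r k m) M j) :
    (k j = m → j = M) ∧ closedBall (x j) (r j) ⊆ closedBall (x M) (a m + 3 * a (m + 1)) := by
  have key : j = M ∨ (m + 1 ≤ k j ∧ ∃ u, m + 1 ≤ k u ∧ BallsMeet x r k m M u ∧
      Relation.ReflTransGen (BallsMeet x r k (m + 1)) u j) := by
    induction hj with
    | refl => exact Or.inl rfl
    | @tail b c _ hbc ih =>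
      by_cases hcM : c = M
      · exact Or.inl hcM
      right
      obtain ⟨hb, hc, w, hwb, hwc⟩ := hbc
      have h₁ := ha m
      have h₂ := hpos (m + 1)
      have h₃ := hpos m
      rcases ih with rfl | ⟨hb', u, hu, hMu, hub⟩
      · have hkc : m + 1 ≤ k c := by
          by_contra hlt
          have := hsep b c (Ne.symm hcM) (by omega) w hwb w hwc
          rw [dist_self, hM] at this
          linarith
        exact ⟨hkc, c, hkc, ⟨hb, hc, w, hwb, hwc⟩, .refl⟩
      · have hkc : m + 1 ≤ k c := by
          by_contra hlt
          obtain ⟨-, -, v, hvM, hvu⟩ := hMu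
          have := hsep M c (Ne.symm hcM) (by omega) v hvM w hwc
          have := hdiam u b hu hub v hvu w hwb
          rw [hM] at *
          linarith
        exact ⟨hkc, u, hu, hMu, hub.tail ⟨hb', hkc, w, hwb, hwc⟩⟩
  have hrM := hr M
  rw [hM] at hrM
  rcases key with rfl | ⟨hkj, u, hu, ⟨-, -, v, hvM, hvu⟩, huj⟩
  · exact ⟨fun _ => rfl, closedBall_subset_closedBall (by linarith [hpos (m + 1)])⟩
  · refine ⟨fun h => by omega, fun q hq => ?_⟩
    have h₁ := hdiam u j hu huj v hvu q hq
    rw [mem_closedBall] at hvM ⊢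
    have := dist_triangle q v (x M)
    rw [dist_comm q v] at this
    linarith

/-- A chain of balls of level at least `m` has diameter less than `3 * a m`. -/
lemma dist_lt_of_chain (hpos : ∀ m, 0 < a m) (ha : ∀ m, 6 * a (m + 1) < a m)
    (hr : ∀ i, r i ≤ a (k i))
    (hsep : ∀ i j, i ≠ j → k i = k j →
      ∀ s ∈ closedBall (x i) (r i), ∀ t ∈ closedBall (x j) (r j), 3 * a (k i) ≤ dist s t)
    (hk : BddAbove (range k)) (m : ℤ) :
    ∀ i j, m ≤ k i → Relation.ReflTransGen (BallsMeet x r k m) i j →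
      ∀ p ∈ closedBall (x i) (r i), ∀ q ∈ closedBall (x j) (r j), dist p q < 3 * a m := by
  obtain ⟨K, hK⟩ := hk
  have hK' : ∀ i, k i ≤ K := fun i => hK (mem_range_self i)
  obtain ⟨n, hn⟩ : ∃ n : ℕ, K < m + n := ⟨(K - m + 1).toNat, by omega⟩
  induction n generalizing m with
  | zero =>
    intro i _ hi
    have := hK' i
    push_cast at hn
    omega
  | succ n ih =>
    have hdiam := ih (m + 1) (by push_cast at hn; omega)
    intro i j hi hij p hp q hq
    have key : (m + 1 ≤ k i ∧ m + 1 ≤ k j ∧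
        Relation.ReflTransGen (BallsMeet x r k (m + 1)) i j) ∨
        ∃ M, k M = m ∧ Relation.ReflTransGen (BallsMeet x r k m) i M ∧
          Relation.ReflTransGen (BallsMeet x r k m) M j := by
      clear hq
      induction hij with
      | refl =>
        rcases hi.lt_or_eq with h | h
        · exact Or.inl ⟨by omega, by omega, .refl⟩
        · exact Or.inr ⟨i, h.symm, .refl, .refl⟩
      | @tail b c hib hbc ih =>
        rcases ih with ⟨h₁, h₂, h₃⟩ | ⟨M, h₁, h₂, h₃⟩
        · rcases hbc.2.1.lt_or_eq with h | h
          · exact Or.inl ⟨h₁, by omega, h₃.tail ⟨h₂, by omega, hbc.2.2⟩⟩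
          · exact Or.inr ⟨c, h.symm, hib.tail hbc, .refl⟩
        · exact Or.inr ⟨M, h₁, h₂, h₃.tail hbc⟩
    have h₁ := ha m
    have h₂ := hpos (m + 1)
    rcases key with ⟨hki, -, h⟩ | ⟨M, hM, hiM, hMj⟩
    · linarith [hdiam i j hki h p hp q hq]
    · have hMi : Relation.ReflTransGen (BallsMeet x r k m) M i :=
        Relation.reflTransGen_swap.1 (Relation.ReflTransGen.mono (fun _ _ h => h.symm) _ _ hiM)
      have h₃ := (eq_and_subset_closedBall_of_chain hpos ha hr hsep hdiam hM hMi).2 hp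
      have h₄ := (eq_and_subset_closedBall_of_chain hpos ha hr hsep hdiam hM hMj).2 hq
      rw [mem_closedBall] at h₃ h₄
      linarith [dist_triangle_right p q (x M)]

end BallChains

/-- Lemma A.1 (unions of overlapping balls in a metric space): a chain-connected
family of balls with geometric decay of radii and separation within levels is
contained in a controlled dilate of the ball whose level is minimal. Balls are
indexed by `1 ≤ i < N` with `N ∈ ℕ ∪ {∞}`, `N ≥ 2`. -/
theorem statement9 {X : Type u} [MetricSpace X] (ξ r₀ : ℝ) (hξ : 6 < ξ) (hr₀ : 0 < r₀)
    (N : ℕ∞) (hN : 2 ≤ N) (x : ℕ → X) (r : ℕ → ℝ) (k : ℕ → ℤ)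
    (hbd : ∃ b : ℤ, ∀ i : ℕ, 1 ≤ i → (i : ℕ∞) < N → b ≤ k i)
    (hchain : ∀ j : ℕ, 2 ≤ j → (j : ℕ∞) < N → ∀ i₁ i₂ : ℕ,
      1 ≤ i₁ → i₁ ≤ j → 1 ≤ i₂ → i₂ ≤ j →
      ∃ (n : ℕ) (c : Fin (n + 1) → ℕ), c 0 = i₁ ∧ c (Fin.last n) = i₂ ∧
        (∀ l, 1 ≤ c l ∧ c l ≤ j) ∧
        ∀ l : Fin n, (closedBall (x (c l.castSucc)) (r (c l.castSucc)) ∩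
          closedBall (x (c l.succ)) (r (c l.succ))).Nonempty)
    (hdecay : ∀ i : ℕ, 1 ≤ i → (i : ℕ∞) < N → r i ≤ ξ ^ (-k i) * r₀)
    (hsep : ∀ i j : ℕ, 1 ≤ i → (i : ℕ∞) < N → 1 ≤ j → (j : ℕ∞) < N → i ≠ j → k i = k j →
      ∀ s ∈ closedBall (x i) (r i), ∀ t ∈ closedBall (x j) (r j),
        3 * ξ ^ (-k i) * r₀ ≤ dist s t) :
    ∃ M : ℕ, (1 ≤ M ∧ (M : ℕ∞) < N ∧ ∀ i : ℕ, 1 ≤ i → (i : ℕ∞) < N → k M ≤ k i) ∧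
      (∀ M' : ℕ, 1 ≤ M' → (M' : ℕ∞) < N →
        (∀ i : ℕ, 1 ≤ i → (i : ℕ∞) < N → k M' ≤ k i) → M' = M) ∧
      (⋃ (i : ℕ) (_ : 1 ≤ i ∧ (i : ℕ∞) < N), closedBall (x i) (r i)) ⊆
        closedBall (x M) ((1 + 3 / ξ) * (ξ ^ (-k M) * r₀)) := by
  have hξ0 : 0 < ξ := by linarith
  set a : ℤ → ℝ := fun m => ξ ^ (-m) * r₀ with ha_def
  have hpos : ∀ m, 0 < a m := fun m => mul_pos (zpow_pos hξ0 _) hr₀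
  have hstep : ∀ m, a m = ξ * a (m + 1) := fun m => by
    simp only [ha_def]
    rw [show -m = 1 + -(m + 1) by ring, zpow_add₀ hξ0.ne', zpow_one, mul_assoc]
  have ha : ∀ m, 6 * a (m + 1) < a m := fun m => by
    rw [hstep m]
    exact mul_lt_mul_of_pos_right hξ (hpos _)
  have hrad : ∀ m, (1 + 3 / ξ) * (ξ ^ (-m) * r₀) = a m + 3 * a (m + 1) := fun m => by
    change (1 + 3 / ξ) * a m = _
    rw [hstep m]
    field_simp
  obtain ⟨M, ⟨hM1, hMN⟩, hMmin⟩ : ∃ M : ℕ, (1 ≤ M ∧ (M : ℕ∞) < N) ∧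
      ∀ i : ℕ, 1 ≤ i → (i : ℕ∞) < N → k M ≤ k i := by
    obtain ⟨b, hb⟩ := hbd
    obtain ⟨_, ⟨M, hM1, hMN, rfl⟩, hmin⟩ :=
      Int.exists_least_of_bdd (P := fun z => ∃ i : ℕ, 1 ≤ i ∧ (i : ℕ∞) < N ∧ k i = z)
        ⟨b, by rintro _ ⟨i, h1, h2, rfl⟩; exact hb i h1 h2⟩
        ⟨k 1, 1, le_rfl, lt_of_lt_of_le (by norm_num) hN, rfl⟩
    exact ⟨M, ⟨hM1, hMN⟩, fun i h1 h2 => hmin _ ⟨i, h1, h2, rfl⟩⟩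
  have main : ∀ i : ℕ, 1 ≤ i → (i : ℕ∞) < N → (k i = k M → i = M) ∧
      closedBall (x i) (r i) ⊆ closedBall (x M) (a (k M) + 3 * a (k M + 1)) := by
    intro i hi hiN
    rcases eq_or_ne i M with rfl | hne
    · refine ⟨fun _ => rfl, closedBall_subset_closedBall ?_⟩
      have : r i ≤ a (k i) := hdecay i hi hiN
      linarith [hpos (k i + 1)]
    have hJN : ((max M i : ℕ) : ℕ∞) < N := by
      rcases max_choice M i with h | h <;> rw [h] <;> assumption
    have hJ : ∀ l, l ≤ max M i → (l : ℕ∞) < N := fun l hl =>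
      lt_of_le_of_lt (by exact_mod_cast hl) hJN
    obtain ⟨n, c, hc0, hcn, hc, hmeet⟩ := hchain (max M i) (by omega) hJN M i hM1
      (le_max_left _ _) hi (le_max_right _ _)
    let ι := {l : ℕ // 1 ≤ l ∧ l ≤ max M i}
    have : Finite ι := Set.Finite.to_subtype (Set.finite_Icc 1 (max M i))
    have hr' : ∀ l : ι, r l ≤ a (k l) := fun l => hdecay l l.2.1 (hJ l l.2.2)
    have hsep' : ∀ l l' : ι, l ≠ l' → k l = k l' → ∀ s ∈ closedBall (x l) (r l),
        ∀ t ∈ closedBall (x l') (r l'), 3 * a (k l) ≤ dist s t := fun l l' hll hk s hs t ht => by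
      have := hsep l l' l.2.1 (hJ l l.2.2) l'.2.1 (hJ l' l'.2.2)
        (fun h => hll (Subtype.ext h)) hk s hs t ht
      rwa [mul_assoc] at this
    have hlift : ∀ l : Fin (n + 1), Relation.ReflTransGen
        (BallsMeet (fun l : ι => x l) (fun l => r l) (fun l => k l) (k M))
        ⟨c 0, hc 0⟩ ⟨c l, hc l⟩ := by
      intro l
      induction l using Fin.induction with
      | zero => exact .refl
      | succ l ih =>
        exact ih.tail ⟨hMmin _ (hc _).1 (hJ _ (hc _).2), hMmin _ (hc _).1 (hJ _ (hc _).2), hmeet l⟩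
    have hres := eq_and_subset_closedBall_of_chain (a := a) hpos ha hr' hsep'
      (dist_lt_of_chain hpos ha hr' hsep' (Set.finite_range _).bddAbove (k M + 1))
      (congrArg k hc0) (hlift (Fin.last n))
    rw [Subtype.ext_iff] at hres
    simpa only [hc0, hcn] using hres
  refine ⟨M, ⟨hM1, hMN, hMmin⟩, fun M' h1 h2 h3 => (main M' h1 h2).1
    (le_antisymm (h3 M hM1 hMN) (hMmin M' h1 h2)), ?_⟩
  rw [hrad]
  exact iUnion₂_subset fun i hi => (main i hi.1 hi.2).2
end
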